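/- arXiv:1204.6697 — 3 statements merged into one kernel-verified Lean document; each statement's English description precedes it below -/
import Mathlib

section
/- For every squarefree positive integer d, the Bianchi group PSL₂(O_d) is finitely presented: there exist a natural number n and a finite set R of elements of the free group on n generators such that PSL₂(O_d) is isomorphic to the group presented by n generators with set of relators R. -/
open IntermediateField

/-- The imaginary quadratic field `ℚ(√-d)`, realized inside `ℂ`. -/
noncomputable abbrev Qd (d : ℕ) : IntermediateField ℚ ℂ :=
  ℚ⟮(Complex.I * (Real.sqrt d : ℂ) : ℂ)⟯

/-- `O_d`: the ring of integers of the imaginary quadratic field `ℚ(√-d)`. -/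
noncomputable abbrev Od (d : ℕ) : Type :=
  NumberField.RingOfIntegers (Qd d)

/-- `SL₂(R)`: the special linear group of 2×2 matrices over `R` of determinant 1. -/
abbrev SL2 (R : Type*) [CommRing R] : Type _ :=
  Matrix.SpecialLinearGroup (Fin 2) R

/-- `PSL₂(R)`: the quotient of `SL₂(R)` by its center. -/
abbrev PSL2 (R : Type*) [CommRing R] : Type _ :=
  SL2 R ⧸ Subgroup.center (SL2 R)


theorem cocycle_trivial {X E Γ : Type*} [TopologicalSpace X] [SimplyConnectedSpace X]
    [LocallyPathConnectedSpace X] [Group Γ] (V : E → Set X) (hVo : ∀ e, IsOpen (V e))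
    (hVc : ∀ e, IsPreconnected (V e)) (hVn : ∀ e, (V e).Nonempty)
    (hcov : ∀ x, ∃ e, x ∈ V e) (τ : E → E → Γ)
    (hτ : ∀ e₁ e₂ e₃ x, x ∈ V e₁ → x ∈ V e₂ → x ∈ V e₃ → τ e₁ e₂ * τ e₂ e₃ = τ e₁ e₃) :
    ∃ φ : E → Γ, ∀ e e', (V e ∩ V e').Nonempty → φ e * τ e e' = φ e' := by
  classical
  let _ : TopologicalSpace Γ := ⊥
  have : DiscreteTopology Γ := ⟨rfl⟩
  choose idx hidx using hcov
  let Z : FiberBundleCore E X Γ :=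
    { baseSet := V
      isOpen_baseSet := hVo
      indexAt := idx
      mem_baseSet_at := hidx
      coordChange := fun i j _ v => v * τ i j
      coordChange_self := by
        intro i x hx v
        have := hτ i i i x hx hx hx
        simp at this
        simp [this]
      continuousOn_coordChange := by
        intro i j
        apply Continuous.continuousOn
        exact (continuous_of_discreteTopology (f := fun v : Γ => v * τ i j)).comp continuous_snd
      coordChange_comp := by
        intro i j k x hx v
        rw [mul_assoc, hτ i j k x hx.1.1 hx.1.2 hx.2] }
  have cov : IsCoveringMap (Bundle.TotalSpace.proj : Bundle.TotalSpace Γ Z.Fiber → X) :=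
    FiberBundle.isCoveringMap
  obtain ⟨x0⟩ : Nonempty X := inferInstance
  obtain ⟨s, ⟨-, hs⟩, -⟩ := cov.existsUnique_continuousMap_lifts (ContinuousMap.id X) x0
    (⟨x0, (1 : Γ)⟩ : Bundle.TotalSpace Γ Z.Fiber) rfl
  have hs' : ∀ x, (s x).proj = x := fun x => congrFun hs x
  let σ : E → X → Γ := fun e x => (Z.localTriv e (s x)).2
  have hσ : ∀ e x, σ e x = (show Γ from (s x).2) * τ (idx x) e := by
    intro e x
    show (Z.localTriv e (s x)).2 = _
    rw [Z.localTriv_apply]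
    show (show Γ from (s x).2) * τ (idx (s x).proj) e = _
    rw [hs' x]
  have hσc : ∀ e, ContinuousOn (σ e) (V e) := by
    intro e
    have h1 : ContinuousOn (Z.localTriv e) (Z.localTriv e).source :=
      (Z.localTriv e).continuousOn_toFun
    have h2 : ContinuousOn (fun x => Z.localTriv e (s x)) (V e) := by
      apply h1.comp s.continuous.continuousOn
      intro x hx
      rw [Z.mem_localTriv_source]
      rw [hs' x]; exact hx
    exact continuous_snd.comp_continuousOn h2
  refine ⟨fun e => σ e (hVn e).some, ?_⟩
  rintro e e' ⟨x, hx, hx'⟩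
  have h1 : σ e (hVn e).some = σ e x := (hVc e).constant (hσc e) (hVn e).some_mem hx
  have h2 : σ e' (hVn e').some = σ e' x := (hVc e').constant (hσc e') (hVn e').some_mem hx'
  show σ e (hVn e).some * _ = σ e' (hVn e').some
  rw [h1, h2, hσ, hσ, mul_assoc, hτ _ _ _ x (hidx x) hx hx']

theorem reach_all {X E : Type*} [TopologicalSpace X] [PreconnectedSpace X]
    (V : E → Set X) (hVo : ∀ e, IsOpen (V e)) (hVn : ∀ e, (V e).Nonempty)
    (hcov : ∀ x, ∃ e, x ∈ V e) (e₀ e : E) :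
    Relation.ReflTransGen (fun e e' => (V e ∩ V e').Nonempty) e₀ e := by
  set r := Relation.ReflTransGen (fun e e' => (V e ∩ V e').Nonempty) e₀ with hr
  by_contra hne
  let A : Set X := ⋃ e ∈ {e | r e}, V e
  let B : Set X := ⋃ e ∈ {e | ¬ r e}, V e
  have hA : IsOpen A := isOpen_biUnion fun e _ => hVo e
  have hB : IsOpen B := isOpen_biUnion fun e _ => hVo e
  obtain ⟨x, -, hx⟩ := isPreconnected_univ (α := X) A B hA hB (by
      intro x _
      obtain ⟨e, he⟩ := hcov x
      by_cases h : r e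
      · left; exact Set.mem_biUnion (show e ∈ {e | r e} from h) he
      · right; exact Set.mem_biUnion (show e ∈ {e | ¬ r e} from h) he)
    (by
      obtain ⟨x, hx⟩ := hVn e₀
      exact ⟨x, trivial, Set.mem_biUnion (show e₀ ∈ {e | r e} from .refl) hx⟩)
    (by
      obtain ⟨x, hx⟩ := hVn e
      exact ⟨x, trivial, Set.mem_biUnion (show e ∈ {e | ¬ r e} from hne) hx⟩)
  simp only [A, B, Set.mem_inter_iff, Set.mem_iUnion, Set.mem_ofPred_eq] at hx
  obtain ⟨⟨e1, h1, hx1⟩, ⟨e2, h2, hx2⟩⟩ := hx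
  exact h2 (Relation.ReflTransGen.tail h1 ⟨x, hx1, hx2⟩)

theorem reach_finite {G F : Type*} (adj : G × F → G × F → Prop) (p₀ : G × F) 
    (h : ∀ p, Relation.ReflTransGen adj p₀ p) (Y : Set (G × F)) (hY : Y.Finite) :
    ∃ T : Set G, T.Finite ∧ p₀.1 ∈ T ∧ (∀ t ∈ T, ∃ f,
      Relation.ReflTransGen (fun p q => adj p q ∧ p.1 ∈ T ∧ q.1 ∈ T) p₀ (t, f)) ∧
      ∀ y ∈ Y, y.1 ∈ T ∧ 
        Relation.ReflTransGen (fun p q => adj p q ∧ p.1 ∈ T ∧ q.1 ∈ T) p₀ y := by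
  have mono : ∀ (T T' : Set G), T ⊆ T' → ∀ p, 
      Relation.ReflTransGen (fun p q => adj p q ∧ p.1 ∈ T ∧ q.1 ∈ T) p₀ p → 
      Relation.ReflTransGen (fun p q => adj p q ∧ p.1 ∈ T' ∧ q.1 ∈ T') p₀ p := by
    intro T T' hT p hp
    refine Relation.ReflTransGen.mono ?_ _ _ hp
    intro a b hab
    exact ⟨hab.1, hT hab.2.1, hT hab.2.2⟩
  have single : ∀ p, ∃ T : Set G, T.Finite ∧ p₀.1 ∈ T ∧ (∀ t ∈ T, ∃ f,
      Relation.ReflTransGen (fun p q => adj p q ∧ p.1 ∈ T ∧ q.1 ∈ T) p₀ (t, f)) ∧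
      p.1 ∈ T ∧ Relation.ReflTransGen (fun p q => adj p q ∧ p.1 ∈ T ∧ q.1 ∈ T) p₀ p := by
    intro p
    induction h p with
    | refl => exact ⟨{p₀.1}, Set.finite_singleton _, rfl, by
        rintro t rfl; exact ⟨p₀.2, .refl⟩, rfl, .refl⟩
    | @tail q r hq hqr ih =>
      obtain ⟨T, hT, h0, hall, hqT, hr⟩ := ih
      have hsub : T ⊆ insert r.1 T := Set.subset_insert _ _
      have key : Relation.ReflTransGen (fun p q => adj p q ∧ p.1 ∈ insert r.1 T ∧ 
          q.1 ∈ insert r.1 T) p₀ r := 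
        (mono _ _ hsub _ hr).tail ⟨hqr, hsub hqT, Set.mem_insert _ _⟩
      refine ⟨insert r.1 T, hT.insert _, hsub h0, ?_, Set.mem_insert _ _, key⟩
      rintro t (rfl | ht)
      · exact ⟨r.2, key⟩
      · obtain ⟨f, hf⟩ := hall t ht
        exact ⟨f, mono _ _ hsub _ hf⟩
  induction Y, hY using Set.Finite.induction_on with
  | empty => exact ⟨{p₀.1}, Set.finite_singleton _, rfl, by
        rintro t rfl; exact ⟨p₀.2, .refl⟩, by simp⟩
  | @insert a Y _ _ ih =>
    obtain ⟨T, hT, h0, hall, hy⟩ := ih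
    obtain ⟨T', hT', h0', hall', ha, ha'⟩ := single a
    refine ⟨T ∪ T', hT.union hT', Or.inl h0, ?_, ?_⟩
    · rintro t (ht | ht)
      · obtain ⟨f, hf⟩ := hall t ht
        exact ⟨f, mono _ _ Set.subset_union_left _ hf⟩
      · obtain ⟨f, hf⟩ := hall' t ht
        exact ⟨f, mono _ _ Set.subset_union_right _ hf⟩
    · rintro y (rfl | h)
      · exact ⟨Or.inr ha, mono _ _ Set.subset_union_right _ ha'⟩
      · exact ⟨Or.inl (hy y h).1, mono _ _ Set.subset_union_left _ (hy y h).2⟩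

theorem fp_of_action {X G F : Type*} [TopologicalSpace X] [SimplyConnectedSpace X]
    [LocallyPathConnectedSpace X] [Group G] [Finite F] (V : G × F → Set X)
    (hVo : ∀ e, IsOpen (V e))
    (hVc : ∀ e, IsPreconnected (V e)) (hVn : ∀ e, (V e).Nonempty)
    (hcov : ∀ x, ∃ e, x ∈ V e)
    (hinv : ∀ k g h f f', (V (g, f) ∩ V (h, f')).Nonempty → (V (k * g, f) ∩ V (k * h, f')).Nonempty)
    (hfin : {s : G | ∃ f f', (V (1, f) ∩ V (s, f')).Nonempty}.Finite) :
    Group.IsFinitelyPresented G := by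
  classical
  set S := {s : G | ∃ f f', (V (1, f) ∩ V (s, f')).Nonempty} with hS
  have hSmem : ∀ p q : G × F, (V p ∩ V q).Nonempty → p.1⁻¹ * q.1 ∈ S := by
    rintro ⟨g, f⟩ ⟨h, f'⟩ hn
    refine ⟨f, f', ?_⟩
    simpa using hinv g⁻¹ g h f f' hn
  obtain ⟨x0⟩ : Nonempty X := inferInstance
  obtain ⟨⟨_, f0⟩, -⟩ := hcov x0
  have hreach := reach_all V hVo hVn hcov (1, f0)
  obtain ⟨T, hT, h1, hall, hY⟩ := reach_finite _ (1, f0) hreach 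
    (((insert 1 S : Set G)) ×ˢ (Set.univ : Set F)) ((hfin.insert 1).prod Set.finite_univ)
  have hST : ∀ s ∈ S, s ∈ T := fun s hs => (hY (s, f0) ⟨Or.inr hs, trivial⟩).1
  replace h1 : (1 : G) ∈ T := h1
  have : Finite T := hT
  let rels : Set (FreeGroup T) := 
    {w | ∃ s t u : T, s.1 * t.1 = u.1 ∧ w = FreeGroup.of s * FreeGroup.of t * (FreeGroup.of u)⁻¹}
  have hrels : rels.Finite := by
    apply (Set.finite_range (fun p : T × T × T => 
      FreeGroup.of p.1 * FreeGroup.of p.2.1 * (FreeGroup.of p.2.2)⁻¹)).subset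
    rintro w ⟨s, t, u, -, rfl⟩
    exact ⟨(s, t, u), rfl⟩
  have : Finite rels := hrels
  let Γ := PresentedGroup rels
  let x : G → Γ := fun g => if h : g ∈ T then PresentedGroup.of ⟨g, h⟩ else 1
  have hx : ∀ s t, s ∈ T → t ∈ T → s * t ∈ T → x s * x t = x (s * t) := by
    intro s t hs ht hst
    simp only [x, hs, ht, hst, dif_pos]
    have := PresentedGroup.one_of_mem (rels := rels) (x := FreeGroup.of ⟨s, hs⟩ * 
      FreeGroup.of ⟨t, ht⟩ * (FreeGroup.of ⟨s * t, hst⟩)⁻¹) ⟨⟨s, hs⟩, ⟨t, ht⟩, ⟨_, hst⟩, rfl, rfl⟩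
    rw [map_mul, map_mul, map_inv, mul_inv_eq_one] at this
    exact this
  have hx1 : x 1 = 1 := by
    have := hx 1 1 h1 h1 (by simpa using h1)
    simpa using this
  obtain ⟨φ, hφ⟩ := cocycle_trivial V hVo hVc hVn hcov (fun p q => x (p.1⁻¹ * q.1)) (by
    intro p q r y hp hq hr
    have := hx (p.1⁻¹ * q.1) (q.1⁻¹ * r.1) (hST _ (hSmem _ _ ⟨y, hp, hq⟩)) 
      (hST _ (hSmem _ _ ⟨y, hq, hr⟩)) (by
        have := (hST _ (hSmem _ _ ⟨y, hp, hr⟩))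
        convert this using 1
        group)
    rw [this]
    congr 1
    group)
  have hpath : ∀ (k : G) (p : G × F), Relation.ReflTransGen (fun p q => 
      (V p ∩ V q).Nonempty ∧ p.1 ∈ T ∧ q.1 ∈ T) (1, f0) p → φ (k * p.1, p.2) = φ (k, f0) * x p.1 := by
    intro k p hp
    induction hp with
    | refl => simp [hx1]
    | @tail q r hq hqr ih =>
      obtain ⟨hn, hqT, hrT⟩ := hqr
      have h2 := hφ (k * q.1, q.2) (k * r.1, r.2) (hinv k _ _ _ _ hn)
      rw [← h2, ih]
      simp only [mul_inv_rev]
      have e : q.1⁻¹ * k⁻¹ * (k * r.1) = q.1⁻¹ * r.1 := by group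
      rw [e, mul_assoc, hx _ _ hqT (hST _ (hSmem _ _ hn)) (by simpa using hrT)]
      simp
  have hf : ∀ k f, φ (k, f) = φ (k, f0) := by
    intro k f
    have := hpath k (1, f) (hY (1, f) ⟨Or.inl rfl, trivial⟩).2
    simpa [hx1] using this
  have hψ : ∀ k, ∀ t ∈ T, φ (k * t, f0) = φ (k, f0) * x t := by
    intro k t ht
    obtain ⟨f, hr⟩ := hall t ht
    rw [← hf (k * t) f]
    exact hpath k (t, f) hr
  let π : Γ →* G := PresentedGroup.toGroup (rels := rels) (f := fun t : T => t.1) (by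
    rintro w ⟨s, t, u, h, rfl⟩
    simp [h])
  have hπx : ∀ t ∈ T, π (x t) = t := by
    intro t ht
    simp only [x, ht, dif_pos]
    exact PresentedGroup.toGroup.of _
  have hmain : ∀ γ : Γ, ∀ k, φ (k * π γ, f0) = φ (k, f0) * γ := by
    intro γ
    induction γ using PresentedGroup.induction_on with
    | _ w =>
    induction w using FreeGroup.induction_on with
    | C1 => intro k; simp
    | of t => 
      intro k
      have h3 : x t.1 = PresentedGroup.mk rels (FreeGroup.of t) := by
        simp only [x, t.2, dif_pos]; rfl
      rw [← h3, hπx _ t.2]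
      exact hψ k _ t.2
    | inv_of t ih =>
      intro k
      have := ih (k * (π (PresentedGroup.mk rels (FreeGroup.of t)))⁻¹)
      rw [inv_mul_cancel_right] at this
      rw [this, map_inv, map_inv]
      simp
    | mul a b iha ihb =>
      intro k
      rw [map_mul, map_mul, ← mul_assoc, ihb, iha, mul_assoc]
  have hinj : Function.Injective π := by
    rw [injective_iff_map_eq_one]
    intro γ hγ
    have := hmain γ 1
    rw [hγ] at this
    simpa using this
  have hsurj : Function.Surjective π := by
    intro g
    rw [← MonoidHom.mem_range]
    have : ∀ p : G × F, Relation.ReflTransGen (fun e e' => (V e ∩ V e').Nonempty) (1, f0) p → 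
        p.1 ∈ π.range := by
      intro p hp
      induction hp with
      | refl => exact one_mem _
      | @tail q r hq hqr ih =>
        have h5 : q.1⁻¹ * r.1 ∈ π.range := ⟨_, hπx _ (hST _ (hSmem _ _ hqr))⟩
        simpa using mul_mem ih h5
    exact this (g, f0) (hreach _)
  exact Group.IsFinitelyPresented.equiv (MulEquiv.ofBijective π ⟨hinj, hsurj⟩)

open Complex ComplexConjugate in
noncomputable def qv (A : ℝ × ℂ × ℝ) (x y : ℂ) : ℝ :=
  A.1 * normSq x + 2 * (conj x * y * A.2.1).re + A.2.2 * normSq y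

open Complex ComplexConjugate in
noncomputable def bv (A : ℝ × ℂ × ℝ) (x y z u : ℂ) : ℂ :=
  A.1 * (conj x * z) + A.2.1 * (conj x * u) + conj A.2.1 * (conj y * z) + A.2.2 * (conj y * u)

noncomputable def hact (M : Matrix (Fin 2) (Fin 2) ℂ) (A : ℝ × ℂ × ℝ) : ℝ × ℂ × ℝ :=
  (qv A (M 0 0) (M 1 0), bv A (M 0 0) (M 1 0) (M 0 1) (M 1 1), qv A (M 0 1) (M 1 1))

noncomputable def hdisc (A : ℝ × ℂ × ℝ) : ℝ := A.1 * A.2.2 - Complex.normSq A.2.1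

theorem hact_mul (g M : Matrix (Fin 2) (Fin 2) ℂ) (A : ℝ × ℂ × ℝ) :
    hact (g * M) A = hact M (hact g A) := by
  obtain ⟨a, b, c⟩ := A
  simp only [hact, qv, bv, Matrix.mul_apply, Fin.sum_univ_two]
  refine Prod.ext ?_ (Prod.ext ?_ ?_)
  · simp [Complex.normSq_apply]; ring
  · apply Complex.ext <;> simp [Complex.normSq_apply] <;> ring
  · simp [Complex.normSq_apply]; ring

theorem hdisc_hact (M : Matrix (Fin 2) (Fin 2) ℂ) (A : ℝ × ℂ × ℝ) :
    hdisc (hact M A) = Complex.normSq M.det * hdisc A := by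
  obtain ⟨a, b, c⟩ := A
  simp [hact, hdisc, qv, bv, Matrix.det_fin_two, Complex.normSq_apply]; ring

theorem hact_smul (r : ℂ) (M : Matrix (Fin 2) (Fin 2) ℂ) (A : ℝ × ℂ × ℝ) :
    hact (r • M) A = Complex.normSq r • hact M A := by
  obtain ⟨a, b, c⟩ := A
  simp only [hact, qv, bv, Matrix.smul_apply, smul_eq_mul]
  refine Prod.ext ?_ (Prod.ext ?_ ?_)
  · simp [Complex.normSq_apply]; ring
  · apply Complex.ext <;> simp [Complex.normSq_apply] <;> ring
  · simp [Complex.normSq_apply]; ring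

theorem hact_one (A : ℝ × ℂ × ℝ) : hact 1 A = A := by
  obtain ⟨a, b, c⟩ := A
  simp [hact, qv, bv]

theorem hact_linear (M : Matrix (Fin 2) (Fin 2) ℂ) : IsLinearMap ℝ (hact M) := by
  constructor
  · rintro ⟨a, b, c⟩ ⟨a', b', c'⟩
    refine Prod.ext ?_ (Prod.ext ?_ ?_)
    · simp [hact, qv, Complex.normSq_apply]; ring
    · apply Complex.ext <;> simp [hact, bv] <;> ring
    · simp [hact, qv, Complex.normSq_apply]; ring
  · rintro r ⟨a, b, c⟩
    refine Prod.ext ?_ (Prod.ext ?_ ?_)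
    · simp [hact, qv, Complex.normSq_apply]; ring
    · apply Complex.ext <;> simp [hact, bv] <;> ring
    · simp [hact, qv, Complex.normSq_apply]; ring

theorem hact_continuous (M : Matrix (Fin 2) (Fin 2) ℂ) : Continuous (hact M) := by
  unfold hact qv bv
  fun_prop

theorem qv_id (A : ℝ × ℂ × ℝ) (x y : ℂ) :
    A.1 * qv A x y = Complex.normSq (A.1 * x + A.2.1 * y) + hdisc A * Complex.normSq y := by
  simp [qv, hdisc, Complex.normSq_apply]; ring

theorem qv_id' (A : ℝ × ℂ × ℝ) (x y : ℂ) :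
    A.2.2 * qv A x y = Complex.normSq (A.2.2 * y + (starRingEnd ℂ) A.2.1 * x)
      + hdisc A * Complex.normSq x := by
  simp [qv, hdisc, Complex.normSq_apply]; ring

def posX : Set (ℝ × ℂ × ℝ) := {A | 0 < A.1 ∧ 0 < hdisc A}

def sieg (c₁ c₂ : ℝ) : Set (ℝ × ℂ × ℝ) :=
  {A | 0 < A.1 ∧ ‖A.2.1‖ < c₁ * A.1 ∧ A.1 ^ 2 < c₂ * hdisc A}

theorem hdisc_continuous : Continuous hdisc := by
  unfold hdisc
  have := Complex.continuous_normSq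
  fun_prop

theorem posX_open : IsOpen posX :=
  (isOpen_lt continuous_const continuous_fst).inter (isOpen_lt continuous_const hdisc_continuous)

theorem sieg_open (c₁ c₂ : ℝ) : IsOpen (sieg c₁ c₂) := by
  have := hdisc_continuous
  have h1 : IsOpen {A : ℝ × ℂ × ℝ | 0 < A.1} := isOpen_lt continuous_const continuous_fst
  have h2 : IsOpen {A : ℝ × ℂ × ℝ | ‖A.2.1‖ < c₁ * A.1} := 
    isOpen_lt (by fun_prop) (by fun_prop)
  have h3 : IsOpen {A : ℝ × ℂ × ℝ | A.1 ^ 2 < c₂ * hdisc A} := 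
    isOpen_lt (by fun_prop) (by fun_prop)
  exact h1.inter (h2.inter h3)

theorem cvx_key (k : ℝ) : Convex ℝ {A : ℝ × ℂ × ℝ | 0 < A.1 ∧ k * A.1 ^ 2 < hdisc A} := by
  rintro ⟨a, b, c⟩ ⟨ha, hb⟩ ⟨a', b', c'⟩ ⟨ha', hb'⟩ s t hs ht hst
  simp only [hdisc] at *
  have hpos : 0 < s * a + t * a' := by
    rcases hs.eq_or_lt with rfl | hs
    · have : t = 1 := by linarith
      subst this; simpa using ha'
    · positivity
  refine ⟨by simpa using hpos, ?_⟩
  simp only [Complex.normSq_apply] at *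
  simp
  set e := c - k * a with he
  set e' := c' - k * a' with he'
  have h1 : b.re ^ 2 + b.im ^ 2 < a * e := by rw [he]; nlinarith
  have h2 : b'.re ^ 2 + b'.im ^ 2 < a' * e' := by rw [he']; nlinarith
  have hep : 0 < e := by
    have : 0 < a * e := by nlinarith [sq_nonneg b.re, sq_nonneg b.im]
    exact (mul_pos_iff_of_pos_left ha).mp this
  have hep' : 0 < e' := by
    have : 0 < a' * e' := by nlinarith [sq_nonneg b'.re, sq_nonneg b'.im]
    exact (mul_pos_iff_of_pos_left ha').mp this
  have hcross : 2 * (b.re * b'.re + b.im * b'.im) ≤ a * e' + a' * e := by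
    apply abs_le_of_sq_le_sq' _ (by positivity) |>.2
    have h3 : (b.re * b'.re + b.im * b'.im) ^ 2 ≤ (b.re ^ 2 + b.im ^ 2) * (b'.re ^ 2 + b'.im ^ 2) := by
      nlinarith [sq_nonneg (b.re * b'.im - b.im * b'.re)]
    have h4 : (b.re ^ 2 + b.im ^ 2) * (b'.re ^ 2 + b'.im ^ 2) ≤ (a * e) * (a' * e') := by
      apply mul_le_mul h1.le h2.le <;> positivity
    nlinarith [sq_nonneg (a * e' - a' * e)]
  have hst' : 0 ≤ s * t := mul_nonneg hs ht
  have h5 := mul_le_mul_of_nonneg_left hcross hst'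
  have h6 : s ^ 2 * (b.re ^ 2 + b.im ^ 2) + t ^ 2 * (b'.re ^ 2 + b'.im ^ 2) <
      s ^ 2 * (a * e) + t ^ 2 * (a' * e') := by
    rcases hs.eq_or_lt with rfl | hs
    · have : t = 1 := by linarith
      subst this; simpa using h2
    · have := mul_lt_mul_of_pos_left h1 (pow_pos hs 2)
      have := mul_le_mul_of_nonneg_left h2.le (sq_nonneg t)
      linarith
  have hc : c = e + k * a := by rw [he]; ring
  have hc' : c' = e' + k * a' := by rw [he']; ring
  rw [hc, hc']
  nlinarith

theorem posX_convex : Convex ℝ posX := by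
  have := cvx_key 0
  simpa [posX] using this

theorem sieg_convex (c₁ c₂ : ℝ) (h₂ : 0 < c₂) : Convex ℝ (sieg c₁ c₂) := by
  have h1 := cvx_key (1 / c₂)
  have h2 : Convex ℝ {A : ℝ × ℂ × ℝ | ‖A.2.1‖ < c₁ * A.1} := by
    rintro ⟨a, b, c⟩ hb ⟨a', b', c'⟩ hb' s t hs ht hst
    simp only [Set.mem_ofPred_eq] at *
    simp
    have : ‖(s:ℂ) * b + t * b'‖ ≤ s * ‖b‖ + t * ‖b'‖ := by
      refine (norm_add_le _ _).trans ?_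
      simp [abs_of_nonneg hs, abs_of_nonneg ht]
    refine this.trans_lt ?_
    rcases hs.eq_or_lt with rfl | hs
    · have : t = 1 := by linarith
      subst this; simpa using hb'
    · have := mul_lt_mul_of_pos_left hb hs
      have := mul_le_mul_of_nonneg_left hb'.le ht
      nlinarith
  have : sieg c₁ c₂ = {A : ℝ × ℂ × ℝ | 0 < A.1 ∧ 1 / c₂ * A.1 ^ 2 < hdisc A} ∩ 
      {A : ℝ × ℂ × ℝ | ‖A.2.1‖ < c₁ * A.1} := by
    ext A
    simp only [sieg, Set.mem_ofPred_eq, Set.mem_inter_iff]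
    rw [one_div, inv_mul_lt_iff₀ h₂]
    tauto
  rw [this]
  exact h1.inter h2

theorem posX_hact {M : Matrix (Fin 2) (Fin 2) ℂ} (hM : M.det ≠ 0) {A : ℝ × ℂ × ℝ} 
    (hA : A ∈ posX) : hact M A ∈ posX := by
  refine ⟨?_, ?_⟩
  · have h := qv_id A (M 0 0) (M 1 0)
    have : 0 < A.1 * qv A (M 0 0) (M 1 0) := by
      rw [h]
      by_cases h10 : M 1 0 = 0
      · have h00 : M 0 0 ≠ 0 := by
          rintro h; apply hM; rw [Matrix.det_fin_two, h, h10]; simp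
        simp only [h10, mul_zero, add_zero, map_zero]
        apply Complex.normSq_pos.2
        exact mul_ne_zero (by exact_mod_cast hA.1.ne') h00
      · have := mul_pos hA.2 (Complex.normSq_pos.2 h10)
        have := Complex.normSq_nonneg (A.1 * M 0 0 + A.2.1 * M 1 0)
        linarith
    exact (mul_pos_iff_of_pos_left hA.1).mp this
  · rw [hdisc_hact]
    exact mul_pos (Complex.normSq_pos.2 hM) hA.2

theorem sieg_cone (c₁ c₂ : ℝ) {r : ℝ} (hr : 0 < r) {A : ℝ × ℂ × ℝ} (hA : A ∈ sieg c₁ c₂) :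
    r • A ∈ sieg c₁ c₂ := by
  obtain ⟨a, b, c⟩ := A
  obtain ⟨h1, h2, h3⟩ := hA
  simp only [hdisc] at h1 h2 h3
  refine ⟨by simpa using mul_pos hr h1, ?_, ?_⟩
  · simp [abs_of_pos hr]
    nlinarith
  · simp [hdisc]
    have := mul_lt_mul_of_pos_left h3 (pow_pos hr 2)
    nlinarith

theorem lin_bound {a c₁ l : ℝ} {b x y : ℂ} (ha : 0 < a) (_hl : 0 ≤ l) (hb : ‖b‖ < c₁ * a)
    (h1 : ‖a * x + b * y‖ ≤ l * a) (h2 : ‖y‖ ≤ l) : ‖x‖ ≤ (1 + c₁) * l := by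
  have h3 : (a : ℂ) * x = (a * x + b * y) - b * y := by ring
  have h4 : a * ‖x‖ ≤ l * a + (c₁ * a) * l := by
    calc a * ‖x‖ = ‖(a : ℂ) * x‖ := by simp [abs_of_pos ha]
      _ ≤ ‖a * x + b * y‖ + ‖b * y‖ := by
        have h9 := norm_sub_le ((a : ℂ) * x + b * y) (b * y)
        rwa [← h3] at h9
      _ ≤ l * a + (c₁ * a) * l := by
        rw [norm_mul]
        have : ‖b‖ * ‖y‖ ≤ (c₁ * a) * l := mul_le_mul hb.le h2 (norm_nonneg _) 
          ((norm_nonneg _).trans hb.le)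
        linarith
  have : a * ‖x‖ ≤ a * ((1 + c₁) * l) := by linarith
  exact le_of_mul_le_mul_left this ha

set_option maxHeartbeats 1600000 in
theorem sieg_bound (c₁ c₂ D : ℝ) (h₁ : 0 < c₁) (h₂ : 0 < c₂) (hD : 0 ≤ D) :
    ∃ C : ℝ, ∀ P : Matrix (Fin 2) (Fin 2) ℂ, (∀ i j, P i j = 0 ∨ 1 ≤ ‖P i j‖) → P.det ≠ 0 →
      ‖P.det‖ ≤ D → ∀ A ∈ sieg c₁ c₂, hact P A ∈ sieg c₁ c₂ → ∀ i j, ‖P i j‖ ≤ C := by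
  set K := D ^ 2 * (1 + c₁ ^ 2 * c₂) with hK
  have hK0 : 0 ≤ K := by positivity
  set l : ℝ := 1 + c₂ ^ 2 * D ^ 2 + K * c₂ + c₂ * D ^ 2 + K with hl
  have hl1 : 1 ≤ l := by
    rw [hl]
    have : 0 ≤ c₂ ^ 2 * D ^ 2 + K * c₂ + c₂ * D ^ 2 + K := by positivity
    linarith
  have hl0 : 0 ≤ l := by linarith
  have hll : l ≤ l ^ 2 := by nlinarith
  refine ⟨(1 + c₁) * l + (1 + 2 * c₁) * D, ?_⟩
  intro P hP hdet hPD A hA hA'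
  obtain ⟨ha, hb, hd⟩ := hA
  obtain ⟨ha', hb', hd'⟩ := hA'
  have hdh := hdisc_hact P A
  have hid1 := qv_id A (P 0 0) (P 1 0)
  have hid2 := qv_id A (P 0 1) (P 1 1)
  set a := A.1
  set b := A.2.1
  set Δ := hdisc A
  set x := P 0 0
  set y := P 1 0
  set z := P 0 1
  set u := P 1 1
  have hΔ : 0 < Δ := by
    have : 0 < c₂ * Δ := lt_trans (by positivity) hd
    exact (mul_pos_iff_of_pos_left h₂).mp this
  by_cases hy : y = 0
  · have hdt : P.det = x * u := by 
      rw [Matrix.det_fin_two]; show x * u - z * y = _; rw [hy]; ring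
    have hx0 : x ≠ 0 := by rintro h; apply hdet; rw [hdt, h, zero_mul]
    have hu0 : u ≠ 0 := by rintro h; apply hdet; rw [hdt, h, mul_zero]
    have hx1 : 1 ≤ ‖x‖ := (hP 0 0).resolve_left hx0
    have hu1 : 1 ≤ ‖u‖ := (hP 1 1).resolve_left hu0
    rw [hdt, norm_mul] at hPD
    have hxD : ‖x‖ ≤ D := by nlinarith
    have huD : ‖u‖ ≤ D := by nlinarith
    have hqa : (hact P A).1 = a * Complex.normSq x := by
      show qv A x y = _
      simp [qv, hy, a]
    have hbb : (hact P A).2.1 = (starRingEnd ℂ) x * (a * z + b * u) := by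
      show bv A x y z u = _
      simp [bv, hy, a, b]; ring
    rw [hqa, hbb, norm_mul, RCLike.norm_conj, Complex.normSq_eq_norm_sq] at hb'
    have h3 : ‖a * z + b * u‖ ≤ c₁ * a * ‖x‖ := by
      have : ‖x‖ * ‖a * z + b * u‖ ≤ ‖x‖ * (c₁ * a * ‖x‖) := by nlinarith
      exact le_of_mul_le_mul_left this (by linarith)
    have h4 : ‖(a * z + b * u)‖ ≤ (D * c₁) * a := by
      have := mul_le_mul_of_nonneg_left hxD (show 0 ≤ c₁ * a by positivity)
      linarith
    have hz : ‖z‖ ≤ 2 * c₁ * D := by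
      have h3 : (a : ℂ) * z = (a * z + b * u) - b * u := by ring
      have h5 : a * ‖z‖ ≤ (D * c₁) * a + (c₁ * a) * D := by
        calc a * ‖z‖ = ‖(a : ℂ) * z‖ := by simp [abs_of_pos ha]
          _ ≤ ‖a * z + b * u‖ + ‖b * u‖ := by
            have h9 := norm_sub_le ((a : ℂ) * z + b * u) (b * u)
            rwa [← h3] at h9
          _ ≤ _ := by
            rw [norm_mul]
            have : ‖b‖ * ‖u‖ ≤ (c₁ * a) * D := mul_le_mul hb.le huD (norm_nonneg _) 
              ((norm_nonneg _).trans hb.le)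
            linarith
      have : a * ‖z‖ ≤ a * (2 * c₁ * D) := by linarith
      exact le_of_mul_le_mul_left this ha
    have p1 : 0 ≤ (1 + c₁) * l := by positivity
    have p2 : 0 ≤ c₁ * D := by positivity
    intro i j
    fin_cases i <;> fin_cases j
    · show ‖x‖ ≤ _; linarith
    · show ‖z‖ ≤ _; linarith
    · show ‖y‖ ≤ _; rw [hy, norm_zero]; linarith
    · show ‖u‖ ≤ _; linarith
  · have hy1 : 1 ≤ ‖y‖ := (hP 1 0).resolve_left hy
    set a' := (hact P A).1 with ha'def
    set b' := (hact P A).2.1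
    set c' := (hact P A).2.2 with hc'def
    set Δ' := hdisc (hact P A)
    have hΔ' : Δ' ≤ D ^ 2 * Δ := by
      rw [hdh, Complex.normSq_eq_norm_sq]
      apply mul_le_mul_of_nonneg_right _ hΔ.le
      exact pow_le_pow_left₀ (norm_nonneg _) hPD 2
    have hdc : a' * c' = Δ' + ‖b'‖ ^ 2 := by
      rw [← Complex.normSq_eq_norm_sq]; simp [Δ', hdisc, a', b', c']
    change a * a' = _ at hid1
    change a * c' = _ at hid2
    simp only [Complex.normSq_eq_norm_sq] at hid1 hid2
    clear_value a' b' c' Δ'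
    clear_value a b Δ K
    clear_value l
    have e1 : Δ ≤ a * a' := by
      rw [hid1]
      have : Δ * 1 ≤ Δ * ‖y‖ ^ 2 := mul_le_mul_of_nonneg_left (by nlinarith) hΔ.le
      nlinarith [sq_nonneg ‖(a : ℂ) * x + b * y‖]
    have e2 : a' ^ 2 ≤ c₂ * D ^ 2 * Δ := by
      have := mul_le_mul_of_nonneg_left hΔ' h₂.le
      linarith
    have e3 : a' * c' ≤ K * Δ := by
      have : ‖b'‖ ^ 2 ≤ (c₁ * a') ^ 2 := pow_le_pow_left₀ (norm_nonneg _) hb'.le 2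
      have := mul_le_mul_of_nonneg_left e2 (sq_nonneg c₁)
      rw [hdc, hK]
      linarith
    have e4 : c' ≤ K * a := by
      have hc0 : 0 ≤ c' := by
        have : 0 ≤ a * c' := by rw [hid2]; positivity
        exact (mul_nonneg_iff_of_pos_left ha).mp this
      have h5 : Δ * c' ≤ Δ * (K * a) := by
        calc Δ * c' ≤ (a * a') * c' := mul_le_mul_of_nonneg_right e1 hc0
          _ = a * (a' * c') := by ring
          _ ≤ a * (K * Δ) := mul_le_mul_of_nonneg_left e3 ha.le
          _ = _ := by ring
      exact le_of_mul_le_mul_left h5 hΔ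
    have e5 : a' ≤ c₂ * D ^ 2 * a := by
      have h5 : Δ * a' ≤ Δ * (c₂ * D ^ 2 * a) := by
        calc Δ * a' ≤ (a * a') * a' := mul_le_mul_of_nonneg_right e1 ha'.le
          _ = a * (a' ^ 2) := by ring
          _ ≤ a * (c₂ * D ^ 2 * Δ) := mul_le_mul_of_nonneg_left e2 ha.le
          _ = _ := by ring
      exact le_of_mul_le_mul_left h5 hΔ
    have e6 : a * a' ≤ c₂ * D ^ 2 * a ^ 2 := by
      have := mul_le_mul_of_nonneg_left e5 ha.le
      linarith
    have e7 : a * c' ≤ K * a ^ 2 := by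
      have := mul_le_mul_of_nonneg_left e4 ha.le
      linarith
    have e8 : a * a' ≤ Δ * (c₂ ^ 2 * D ^ 2) := by
      have := mul_le_mul_of_nonneg_left hd.le (show 0 ≤ c₂ * D ^ 2 by positivity)
      linarith
    have e9 : a * c' ≤ Δ * (K * c₂) := by
      have := mul_le_mul_of_nonneg_left hd.le hK0
      linarith
    have q1 : 0 ≤ c₂ ^ 2 * D ^ 2 := by positivity
    have q2 : 0 ≤ K * c₂ := by positivity
    have q3 : 0 ≤ c₂ * D ^ 2 := by positivity
    have hy2 : ‖y‖ ≤ l := by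
      apply abs_le_of_sq_le_sq' _ hl0 |>.2
      have : Δ * ‖y‖ ^ 2 ≤ Δ * (c₂ ^ 2 * D ^ 2) := by 
        nlinarith [sq_nonneg ‖(a : ℂ) * x + b * y‖]
      have := le_of_mul_le_mul_left this hΔ
      linarith
    have hu2 : ‖u‖ ≤ l := by
      apply abs_le_of_sq_le_sq' _ hl0 |>.2
      have : Δ * ‖u‖ ^ 2 ≤ Δ * (K * c₂) := by 
        nlinarith [sq_nonneg ‖(a : ℂ) * z + b * u‖]
      have := le_of_mul_le_mul_left this hΔ
      linarith
    have hx3 : ‖(a : ℂ) * x + b * y‖ ≤ l * a := by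
      apply abs_le_of_sq_le_sq' _ (by positivity) |>.2
      have h7 : ‖(a : ℂ) * x + b * y‖ ^ 2 ≤ c₂ * D ^ 2 * a ^ 2 := by 
        have : 0 ≤ Δ * ‖y‖ ^ 2 := by positivity
        linarith
      have : c₂ * D ^ 2 * a ^ 2 ≤ l ^ 2 * a ^ 2 := 
        mul_le_mul_of_nonneg_right (by linarith) (sq_nonneg _)
      linarith
    have hz3 : ‖(a : ℂ) * z + b * u‖ ≤ l * a := by
      apply abs_le_of_sq_le_sq' _ (by positivity) |>.2
      have h7 : ‖(a : ℂ) * z + b * u‖ ^ 2 ≤ K * a ^ 2 := by 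
        have : 0 ≤ Δ * ‖u‖ ^ 2 := by positivity
        linarith
      have : K * a ^ 2 ≤ l ^ 2 * a ^ 2 := 
        mul_le_mul_of_nonneg_right (by linarith) (sq_nonneg _)
      linarith
    have hx4 := lin_bound ha hl0 hb hx3 hy2
    have hz4 := lin_bound ha hl0 hb hz3 hu2
    have p1 : 0 ≤ (1 + 2 * c₁) * D := by positivity
    have p2 : 0 ≤ c₁ * l := by positivity
    intro i j
    fin_cases i <;> fin_cases j
    · show ‖x‖ ≤ _; linarith
    · show ‖z‖ ≤ _; linarith
    · show ‖y‖ ≤ _; linarith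
    · show ‖u‖ ≤ _; linarith

theorem qv_hact (M : Matrix (Fin 2) (Fin 2) ℂ) (A : ℝ × ℂ × ℝ) (x y : ℂ) :
    qv (hact M A) x y = qv A (M 0 0 * x + M 0 1 * y) (M 1 0 * x + M 1 1 * y) := by
  obtain ⟨a, b, c⟩ := A
  simp [hact, qv, bv, Complex.normSq_apply]; ring

theorem qv_scale (A : ℝ × ℂ × ℝ) (r x y : ℂ) :
    qv A (r * x) (r * y) = Complex.normSq r * qv A x y := by
  obtain ⟨a, b, c⟩ := A
  simp [qv, Complex.normSq_apply]; ring

theorem qv_pos {A : ℝ × ℂ × ℝ} (hA : A ∈ posX) {x y : ℂ} (h : x ≠ 0 ∨ y ≠ 0) : 0 < qv A x y := by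
  have h1 : 0 < A.1 * qv A x y := by
    rw [qv_id]
    by_cases hy : y = 0
    · have hx : x ≠ 0 := by simpa [hy] using h
      simp only [hy, mul_zero, add_zero, map_zero]
      exact Complex.normSq_pos.2 (mul_ne_zero (by exact_mod_cast hA.1.ne') hx)
    · have := mul_pos hA.2 (Complex.normSq_pos.2 hy)
      have := Complex.normSq_nonneg (A.1 * x + A.2.1 * y)
      linarith
  exact (mul_pos_iff_of_pos_left hA.1).mp h1

theorem exists_min_of_finite {α : Type*} (s : Set α) (f : α → ℝ) (hs : s.Nonempty)
    (hf : ∀ r, {x | x ∈ s ∧ f x ≤ r}.Finite) : ∃ x ∈ s, ∀ y ∈ s, f x ≤ f y := by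
  obtain ⟨x0, hx0⟩ := hs
  obtain ⟨x, hx, hmin⟩ := Set.exists_min_image _ f (hf (f x0)) ⟨x0, hx0, le_rfl⟩
  refine ⟨x, hx.1, fun y hy => ?_⟩
  by_cases h : f y ≤ f x0
  · exact hmin y ⟨hy, h⟩
  · exact hx.2.trans (not_le.1 h).le

section ring

variable {R : Type*} [CommRing R] (ι : R →+* ℂ)

theorem norm_ge_one (hinj : Function.Injective ι) (F1 : ∀ r : ℝ, {x | ‖ι x‖ ≤ r}.Finite)
    {x : R} (hx : x ≠ 0) : 1 ≤ ‖ι x‖ := by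
  by_contra! h
  have hpos : 0 < ‖ι x‖ := norm_pos_iff.2 (by rwa [Ne, map_eq_zero_iff ι hinj])
  have hI : Function.Injective (fun n : ℕ => x ^ n) := by
    intro n m hnm
    have : ‖ι x‖ ^ n = ‖ι x‖ ^ m := by
      rw [← norm_pow, ← norm_pow, ← map_pow, ← map_pow]; simp only at hnm; rw [hnm]
    exact pow_right_injective₀ hpos h.ne this
  refine Set.infinite_of_injective_forall_mem hI (s := {x | ‖ι x‖ ≤ 1}) ?_ (F1 1)
  intro n
  show ‖ι (x ^ n)‖ ≤ 1
  rw [map_pow, norm_pow]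
  exact pow_le_one₀ hpos.le h.le

theorem dirichlet (ρ : ℝ) (F3 : ∀ z : ℂ, ∃ x : R, ‖z - ι x‖ ≤ ρ) :
    ∃ m : ℕ, ∀ z : ℂ, ∃ n : ℕ, 1 ≤ n ∧ n ≤ m ∧ ∃ x : R, ‖n * z - ι x‖ ≤ 1 / 2 := by
  classical
  obtain ⟨t, -, htf, hcov⟩ := (isCompact_closedBall (0 : ℂ) ρ).finite_cover_balls
    (show (0 : ℝ) < 1 / 4 by norm_num)
  choose q hq using F3
  refine ⟨htf.toFinset.card, fun z => ?_⟩
  have hex : ∀ j : ℕ, ∃ c ∈ t, (j * z - ι (q (j * z))) ∈ Metric.ball c (1 / 4) := by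
    intro j
    have : (j * z - ι (q (j * z))) ∈ Metric.closedBall (0 : ℂ) ρ := by
      simpa using hq (j * z)
    simpa using hcov this
  choose c hct hcb using hex
  obtain ⟨j, hj, k, hk, hjk, hc⟩ := Finset.exists_ne_map_eq_of_card_lt_of_maps_to
    (s := Finset.range (htf.toFinset.card + 1)) (t := htf.toFinset) (f := c) (by simp)
    (by intro j _; simpa using hct j)
  wlog hlt : j < k generalizing j k
  · exact this k hk j hj hjk.symm hc.symm (lt_of_le_of_ne (not_lt.1 hlt) hjk.symm)
  refine ⟨k - j, by omega, by have := Finset.mem_range.1 hk; omega, q (k * z) - q (j * z), ?_⟩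
  have h1 := hcb j
  have h2 := hcb k
  rw [hc] at h1
  rw [mem_ball_iff_norm] at h1 h2
  have e : ((k - j : ℕ) : ℂ) * z - ι (q (k * z) - q (j * z)) =
      ((k * z - ι (q (k * z))) - c k) - ((j * z - ι (q (j * z))) - c k) := by
    rw [Nat.cast_sub hlt.le, map_sub]; ring
  rw [e]
  refine (norm_sub_le _ _).trans ?_
  linarith

theorem mat_finite (F1 : ∀ r : ℝ, {x | ‖ι x‖ ≤ r}.Finite) (C : ℝ) :
    {N : Matrix (Fin 2) (Fin 2) R | ∀ i j, ‖ι (N i j)‖ ≤ C}.Finite := by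
  have h1 : {v : Fin 2 → R | ∀ j, v j ∈ {x | ‖ι x‖ ≤ C}}.Finite := Set.Finite.pi' fun _ => F1 C
  have h2 : {N : Fin 2 → Fin 2 → R | ∀ i, N i ∈ {v : Fin 2 → R | ∀ j, v j ∈ {x | ‖ι x‖ ≤ C}}}.Finite :=
    Set.Finite.pi' fun _ => h1
  exact h2

theorem covering (hinj : Function.Injective ι) (F1 : ∀ r : ℝ, {x | ‖ι x‖ ≤ r}.Finite)
    (ρ : ℝ) (F3 : ∀ z : ℂ, ∃ x : R, ‖z - ι x‖ ≤ ρ) :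
    ∃ c₁ c₂ D : ℝ, 0 < c₁ ∧ 0 < c₂ ∧ 0 ≤ D ∧ ∀ A ∈ posX, ∃ M : Matrix (Fin 2) (Fin 2) R,
      M.det ≠ 0 ∧ ‖ι M.det‖ ≤ D ∧ hact (M.map ι) A ∈ sieg c₁ c₂ := by
  obtain ⟨m, hm⟩ := dirichlet ι ρ F3
  have hρ : 0 ≤ ρ := by
    obtain ⟨x, hx⟩ := F3 0
    exact (norm_nonneg _).trans hx
  have hm1 : 1 ≤ m := by
    obtain ⟨n, h1, h2, -⟩ := hm 0
    omega
  have hι0 : ∀ x, ι x = 0 ↔ x = 0 := fun x => map_eq_zero_iff ι hinj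
  refine ⟨ρ + 1, 2 * m ^ 2, m.factorial, by linarith, by positivity, by positivity, ?_⟩
  intro A hA
  have hΔ := hA.2
  have ha := hA.1
  have hc : 0 < A.2.2 := by
    have : 0 < A.1 * A.2.2 := by
      have h := hA.2
      unfold hdisc at h
      have := Complex.normSq_nonneg A.2.1
      linarith
    exact (mul_pos_iff_of_pos_left ha).mp this
  -- minimal vector
  obtain ⟨⟨p, q⟩, hv0, hvmin⟩ := exists_min_of_finite {v : R × R | v ≠ 0}
    (fun v => qv A (ι v.1) (ι v.2)) ⟨(1, 0), by
      intro h
      have h1 : (1 : R) = 0 := congrArg Prod.fst h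
      have := congrArg ι h1
      simp at this⟩ (by
      intro r
      obtain ⟨C, hC⟩ : ∃ C : ℝ, A.2.2 * r ≤ hdisc A * C ^ 2 ∧ A.1 * r ≤ hdisc A * C ^ 2 ∧ 0 ≤ C := by
        refine ⟨1 + |A.2.2 * r / hdisc A| + |A.1 * r / hdisc A|, ?_, ?_, by positivity⟩
        · rw [← div_le_iff₀' hΔ]
          have := le_abs_self (A.2.2 * r / hdisc A)
          have := abs_nonneg (A.2.2 * r / hdisc A)
          have := abs_nonneg (A.1 * r / hdisc A)
          nlinarith
        · rw [← div_le_iff₀' hΔ]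
          have := le_abs_self (A.1 * r / hdisc A)
          have := abs_nonneg (A.2.2 * r / hdisc A)
          have := abs_nonneg (A.1 * r / hdisc A)
          nlinarith
      apply ((F1 C).prod (F1 C)).subset
      rintro ⟨x, y⟩ ⟨-, hxy⟩
      simp only at hxy
      have h1 := qv_id A (ι x) (ι y)
      have h2 := qv_id' A (ι x) (ι y)
      have h3 := mul_le_mul_of_nonneg_left hxy ha.le
      have h4 := mul_le_mul_of_nonneg_left hxy hc.le
      have h5 := Complex.normSq_nonneg (A.1 * ι x + A.2.1 * ι y)
      have h6 := Complex.normSq_nonneg (A.2.2 * ι y + (starRingEnd ℂ) A.2.1 * ι x)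
      refine ⟨?_, ?_⟩
      · show ‖ι x‖ ≤ C
        apply abs_le_of_sq_le_sq' _ hC.2.2 |>.2
        rw [← Complex.normSq_eq_norm_sq]
        exact le_of_mul_le_mul_left (by linarith [hC.1]) hΔ
      · show ‖ι y‖ ≤ C
        apply abs_le_of_sq_le_sq' _ hC.2.2 |>.2
        rw [← Complex.normSq_eq_norm_sq]
        exact le_of_mul_le_mul_left (by linarith [hC.2.1]) hΔ)
  replace hv0 : ¬ (p = 0 ∧ q = 0) := by
    rintro ⟨rfl, rfl⟩; exact hv0 rfl
  have hvmin' : ∀ x y : R, ¬ (x = 0 ∧ y = 0) → qv A (ι p) (ι q) ≤ qv A (ι x) (ι y) := by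
    intro x y hxy
    exact hvmin (x, y) (by intro h; exact hxy ⟨congrArg Prod.fst h, congrArg Prod.snd h⟩)
  have hvpos : 0 < qv A (ι p) (ι q) := by
    apply qv_pos hA
    rw [Ne, Ne, hι0, hι0]
    tauto
  -- minimal determinant
  obtain ⟨δ, ⟨hδ0, w1, w2, hw⟩, hδmin⟩ := exists_min_of_finite
    {r : R | r ≠ 0 ∧ ∃ w1 w2, p * w2 - q * w1 = r} (fun r => ‖ι r‖) (by
      by_cases hp : p = 0
      · exact ⟨-q, by simpa [hp] using hv0, 1, 0, by ring⟩
      · exact ⟨p, hp, 0, 1, by ring⟩)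
    (fun r => (F1 r).subset fun x hx => hx.2)
  have hιδ : ι δ ≠ 0 := by rwa [Ne, hι0]
  have hdiv : ∀ x : R, (∃ w1 w2, p * w2 - q * w1 = x) → ∃ y : R, (m.factorial : R) * x = y * δ := by
    rintro x ⟨u1, u2, hu⟩
    obtain ⟨n, hn1, hnm, y, hy⟩ := hm (ι x / ι δ)
    have h0 : (n : R) * x - y * δ = 0 := by
      by_contra hne
      have h1 := hδmin ((n : R) * x - y * δ) ⟨hne, n * u1 - y * w1, n * u2 - y * w2, by
        rw [← hu, ← hw]; ring⟩
      have h2 : ι ((n : R) * x - y * δ) = (n * (ι x / ι δ) - ι y) * ι δ := by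
        simp only [map_sub, map_mul, map_natCast]
        field_simp
      rw [h2, norm_mul] at h1
      have : 0 < ‖ι δ‖ := norm_pos_iff.2 hιδ
      nlinarith
    obtain ⟨k, hk⟩ := Nat.dvd_factorial (by omega) hnm
    refine ⟨k * y, ?_⟩
    rw [hk]; push_cast
    linear_combination (k : R) * h0
  obtain ⟨y1, hy1⟩ := hdiv p ⟨0, 1, by ring⟩
  obtain ⟨y2, hy2⟩ := hdiv q ⟨-1, 0, by ring⟩
  have hfac : (m.factorial : ℂ) ≠ 0 := by exact_mod_cast m.factorial_ne_zero
  have hιy1 : (m.factorial : ℂ) * ι p = ι δ * ι y1 := by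
    have := congrArg ι hy1
    simp only [map_mul, map_natCast] at this
    rw [this]; ring
  have hιy2 : (m.factorial : ℂ) * ι q = ι δ * ι y2 := by
    have := congrArg ι hy2
    simp only [map_mul, map_natCast] at this
    rw [this]; ring
  have hy0 : ¬ (y1 = 0 ∧ y2 = 0) := by
    rintro ⟨rfl, rfl⟩
    apply hv0
    constructor
    · rw [← hι0]; simpa [hfac] using hιy1
    · rw [← hι0]; simpa [hfac] using hιy2
  have hδD : ‖ι δ‖ ≤ m.factorial := by
    have h1 := qv_scale A (m.factorial : ℂ) (ι p) (ι q)
    rw [hιy1, hιy2, qv_scale] at h1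
    have h2 := hvmin' y1 y2 hy0
    have h3 := mul_le_mul_of_nonneg_left h2 (Complex.normSq_nonneg (ι δ))
    rw [h1] at h3
    have h4 := le_of_mul_le_mul_right h3 hvpos
    rw [Complex.normSq_eq_norm_sq, Complex.normSq_eq_norm_sq, Complex.norm_natCast] at h4
    exact abs_le_of_sq_le_sq' h4 (by positivity) |>.2
  -- adjust w
  set a := qv A (ι p) (ι q) with hadef
  obtain ⟨s, hs⟩ := F3 (- bv A (ι p) (ι q) (ι w1) (ι w2) / a)
  let M : Matrix (Fin 2) (Fin 2) R := !![p, w1 + s * p; q, w2 + s * q]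
  have hMdet : M.det = δ := by
    rw [Matrix.det_fin_two]; simp [M]; rw [← hw]; ring
  have hMdet' : (M.map ι).det = ι δ := by
    have := (ι.map_det M).symm
    rw [hMdet] at this
    exact this
  have haC : (a : ℂ) ≠ 0 := by exact_mod_cast hvpos.ne'
  have hA1 : (hact (M.map ι) A).1 = a := rfl
  have hb : ‖(hact (M.map ι) A).2.1‖ ≤ ρ * a := by
    have e : (hact (M.map ι) A).2.1 = -((-bv A (ι p) (ι q) (ι w1) (ι w2) / a - ι s) * a) := by
      have : (hact (M.map ι) A).2.1 = bv A (ι p) (ι q) (ι w1) (ι w2) + ι s * a := by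
        rw [hadef]
        simp only [hact, M, Matrix.map_apply, Matrix.of_apply, Matrix.cons_val', Matrix.cons_val_zero, 
          Matrix.cons_val_one, map_add, map_mul, Matrix.cons_val_fin_one]
        apply Complex.ext <;> simp [bv, qv, Complex.normSq_apply] <;> ring
      rw [this]; field_simp; ring
    rw [e, norm_neg, norm_mul, Complex.norm_real, Real.norm_of_nonneg hvpos.le]
    exact mul_le_mul_of_nonneg_right hs hvpos.le
  refine ⟨M, by rwa [hMdet], by rwa [hMdet], by rw [hA1]; exact hvpos, ?_, ?_⟩
  · rw [hA1]; linarith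
  · set A' := hact (M.map ι) A with hA'
    obtain ⟨n, hn1, hnm, y, hy⟩ := hm (- A'.2.1 / a)
    have hn0 : (n : ℂ) ≠ 0 := by 
      have : n ≠ 0 := by omega
      exact_mod_cast this
    have hΔ' : 0 < hdisc A' := by
      rw [hA', hdisc_hact, hMdet']
      exact mul_pos (Complex.normSq_pos.2 hιδ) hΔ
    have h1 := qv_id A' (ι y) n
    have h2 : a ≤ qv A' (ι y) n := by
      rw [hA', qv_hact]
      have e1 : (M.map ι) 0 0 * ι y + (M.map ι) 0 1 * n = ι (p * y + (w1 + s * p) * n) := by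
        simp [M]
      have e2 : (M.map ι) 1 0 * ι y + (M.map ι) 1 1 * n = ι (q * y + (w2 + s * q) * n) := by
        simp [M]
      rw [e1, e2]
      apply hvmin'
      rintro ⟨h3, h4⟩
      have h5 : (n : R) * δ = 0 := by
        rw [← hw]; linear_combination p * h4 - q * h3
      have h6 := congrArg ι h5
      rw [map_mul, map_natCast, map_zero] at h6
      exact mul_ne_zero hn0 hιδ h6
    rw [hA1] at h1 ⊢
    have h3 : Complex.normSq (a * ι y + A'.2.1 * n) ≤ (1 / 2 * a) ^ 2 := by
      rw [Complex.normSq_eq_norm_sq]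
      apply pow_le_pow_left₀ (norm_nonneg _)
      have e : (a * ι y + A'.2.1 * n) = -((n * (- A'.2.1 / a) - ι y) * a) := by
        field_simp; ring
      rw [e, norm_neg, norm_mul, Complex.norm_real, Real.norm_of_nonneg hvpos.le]
      exact mul_le_mul_of_nonneg_right hy hvpos.le
    have h4 : Complex.normSq (n : ℂ) ≤ (m : ℝ) ^ 2 := by
      rw [Complex.normSq_eq_norm_sq, Complex.norm_natCast]
      apply pow_le_pow_left₀ (by positivity)
      exact_mod_cast hnm
    have h5 := mul_le_mul_of_nonneg_left h4 hΔ'.le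
    have h6 := mul_le_mul_of_nonneg_left h2 hvpos.le
    nlinarith

end ring

section ring2

variable {R : Type*} [CommRing R] [IsDomain R] (ι : R →+* ℂ)

theorem orbits_finite (hinj : Function.Injective ι) (F1 : ∀ r : ℝ, {x | ‖ι x‖ ≤ r}.Finite)
    (ρ : ℝ) (F3 : ∀ z : ℂ, ∃ x : R, ‖z - ι x‖ ≤ ρ) (D : ℝ) :
    ∃ F : Set (Matrix (Fin 2) (Fin 2) R), F.Finite ∧
      (∀ f ∈ F, f.det ≠ 0 ∧ ‖ι f.det‖ ≤ D) ∧
      ∀ M : Matrix (Fin 2) (Fin 2) R, M.det ≠ 0 → ‖ι M.det‖ ≤ D →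
        ∃ g : Matrix.SpecialLinearGroup (Fin 2) R, ∃ f ∈ F,
          (g : Matrix (Fin 2) (Fin 2) R) * f = M := by
  classical
  have hred : ∀ δ x : R, ∃ n q : R, x = n + δ * q ∧ (δ ≠ 0 → ‖ι n‖ ≤ ρ * ‖ι δ‖) := by
    intro δ x
    by_cases hδ : δ = 0
    · exact ⟨x, 0, by simp, fun h => absurd hδ h⟩
    obtain ⟨q, hq⟩ := F3 (ι x / ι δ)
    have hδ' : ι δ ≠ 0 := by rwa [Ne, map_eq_zero_iff ι hinj]
    refine ⟨x - δ * q, q, by ring, fun _ => ?_⟩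
    have : ι (x - δ * q) = (ι x / ι δ - ι q) * ι δ := by
      rw [map_sub, map_mul]; field_simp
    rw [this, norm_mul]
    exact mul_le_mul_of_nonneg_right hq (norm_nonneg _)
  have hρ : 0 ≤ ρ := by
    obtain ⟨x, hx⟩ := F3 0
    exact (norm_nonneg _).trans hx
  choose n q hnq hb using hred
  let E : Set (Matrix (Fin 2) (Fin 2) R) := {M | M.det ≠ 0 ∧ ‖ι M.det‖ ≤ D}
  let key : Matrix (Fin 2) (Fin 2) R → R × Matrix (Fin 2) (Fin 2) R :=
    fun M => (M.det, Matrix.of fun i j => n M.det (M i j))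
  have hfin : (key '' E).Finite := by
    refine ((F1 D).prod (mat_finite ι F1 (ρ * D))).subset ?_
    rintro _ ⟨M, ⟨h1, h2⟩, rfl⟩
    refine ⟨h2, fun i j => ?_⟩
    exact (hb _ _ h1).trans (mul_le_mul_of_nonneg_left h2 hρ)
  obtain ⟨F, hFE, hF⟩ := (Set.surjOn_image key E).exists_bijOn_subset
  refine ⟨F, hF.finite_iff_finite.2 hfin, fun f hf => hFE hf, ?_⟩
  intro M h1 h2
  obtain ⟨f, hf, hfM⟩ := hF.surjOn ⟨M, ⟨h1, h2⟩, rfl⟩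
  have hdet : f.det = M.det := congrArg Prod.fst hfM
  have hent : ∀ i j, n M.det (f i j) = n M.det (M i j) := by
    intro i j
    have := congrFun (congrFun (congrArg Prod.snd hfM) i) j
    simpa [key, hdet] using this
  let Q : Matrix (Fin 2) (Fin 2) R := Matrix.of fun i j => q M.det (M i j) - q M.det (f i j)
  have hMQ : M = f + M.det • Q := by
    ext i j
    have e1 := hnq M.det (M i j)
    have e2 := hnq M.det (f i j)
    rw [hent] at e2
    simp only [Matrix.add_apply, Matrix.smul_apply, smul_eq_mul, Q, Matrix.of_apply]
    linear_combination e1 - e2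
  let g : Matrix (Fin 2) (Fin 2) R := 1 + Q * f.adjugate
  have hgf : g * f = M := by
    simp only [g]
    rw [add_mul, one_mul, Matrix.mul_assoc, Matrix.adjugate_mul, hdet, Matrix.mul_smul,
      Matrix.mul_one]
    exact hMQ.symm
  have hg : g.det = 1 := by
    have := congrArg Matrix.det hgf
    rw [Matrix.det_mul, hdet] at this
    exact mul_right_cancel₀ h1 (by rw [this, one_mul])
  exact ⟨⟨g, hg⟩, f, hf, hgf⟩

theorem siegel_finite (hinj : Function.Injective ι) (F1 : ∀ r : ℝ, {x | ‖ι x‖ ≤ r}.Finite)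
    (c₁ c₂ D : ℝ) (h₁ : 0 < c₁) (h₂ : 0 < c₂) (hD : 0 ≤ D)
    (f f' : Matrix (Fin 2) (Fin 2) R) (hf : f.det ≠ 0 ∧ ‖ι f.det‖ ≤ D)
    (hf' : f'.det ≠ 0 ∧ ‖ι f'.det‖ ≤ D) :
    {s : Matrix.SpecialLinearGroup (Fin 2) R | ∃ A, hact (f.map ι) A ∈ sieg c₁ c₂ ∧
      hact (((s : Matrix (Fin 2) (Fin 2) R) * f').map ι) A ∈ sieg c₁ c₂}.Finite := by
  obtain ⟨C, hC⟩ := sieg_bound c₁ c₂ (D * D) h₁ h₂ (mul_nonneg hD hD)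
  have hne : ∀ x : R, x ≠ 0 → ι x ≠ 0 := fun x hx => by rwa [Ne, map_eq_zero_iff ι hinj]
  let P : Matrix.SpecialLinearGroup (Fin 2) R → Matrix (Fin 2) (Fin 2) R :=
    fun s => f.adjugate * (s * f')
  have hfP : ∀ s, f * P s = f.det • ((s : Matrix (Fin 2) (Fin 2) R) * f') := by
    intro s
    simp only [P]
    rw [← Matrix.mul_assoc, Matrix.mul_adjugate, Matrix.smul_mul, Matrix.one_mul]
  have hPi : Function.Injective P := by
    intro s t hst
    have h3 : f.det • ((s : Matrix (Fin 2) (Fin 2) R) * f') =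
      f.det • ((t : Matrix (Fin 2) (Fin 2) R) * f') := by rw [← hfP, ← hfP, hst]
    have h4 := smul_right_injective _ hf.1 h3
    have h5 := congrArg (· * f'.adjugate) h4
    simp only [Matrix.mul_assoc, Matrix.mul_adjugate, Matrix.mul_smul, Matrix.mul_one] at h5
    exact Subtype.ext (smul_right_injective _ hf'.1 h5)
  refine Set.Finite.of_finite_image (f := P) ((mat_finite ι F1 C).subset ?_) hPi.injOn
  rintro _ ⟨s, ⟨A, hA, hA'⟩, rfl⟩
  have hdetP : (P s).det = f.det * f'.det := by
    simp [P, Matrix.det_mul, Matrix.det_adjugate]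
  have hdm : ((P s).map ι).det = ι f.det * ι f'.det := by
    have : ((P s).map ι).det = ι (P s).det := (RingHom.map_det ι (P s)).symm
    rw [this, hdetP, map_mul]
  have key := hC ((P s).map ι) ?_ ?_ ?_ _ hA ?_
  · intro i j
    exact key i j
  · intro i j
    by_cases h : P s i j = 0
    · left; simp [h]
    · right; exact norm_ge_one ι hinj F1 h
  · rw [hdm]
    exact mul_ne_zero (hne _ hf.1) (hne _ hf'.1)
  · rw [hdm, norm_mul]
    exact mul_le_mul hf.2 hf'.2 (norm_nonneg _) hD
  · rw [← hact_mul, ← Matrix.map_mul, hfP]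
    have : (f.det • ((s : Matrix (Fin 2) (Fin 2) R) * f')).map ι =
      ι f.det • (((s : Matrix (Fin 2) (Fin 2) R) * f').map ι) := by
      ext i j
      simp only [Matrix.map_apply, Matrix.smul_apply, smul_eq_mul, map_mul]
    rw [this, hact_smul]
    exact sieg_cone _ _ (Complex.normSq_pos.2 (hne _ hf.1)) hA'

theorem sieg_sub_posX (c₁ c₂ : ℝ) (h₂ : 0 < c₂) : sieg c₁ c₂ ⊆ posX := by
  rintro A ⟨h1, -, h3⟩
  refine ⟨h1, ?_⟩
  by_contra! h
  nlinarith [sq_nonneg A.1]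

theorem SL2_fp (hinj : Function.Injective ι) (F1 : ∀ r : ℝ, {x | ‖ι x‖ ≤ r}.Finite)
    (ρ : ℝ) (F3 : ∀ z : ℂ, ∃ x : R, ‖z - ι x‖ ≤ ρ) :
    Group.IsFinitelyPresented (Matrix.SpecialLinearGroup (Fin 2) R) := by
  obtain ⟨c₁, c₂, D, h₁, h₂, hD, hcov⟩ := covering ι hinj F1 ρ F3
  obtain ⟨F, hFf, hFE, hF⟩ := orbits_finite ι hinj F1 ρ F3 D
  have hne : ∀ x : R, x ≠ 0 → ι x ≠ 0 := fun x hx => by rwa [Ne, map_eq_zero_iff ι hinj]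
  have hdet : ∀ (g : Matrix.SpecialLinearGroup (Fin 2) R) (f : F),
      (((g : Matrix (Fin 2) (Fin 2) R) * (f : Matrix (Fin 2) (Fin 2) R)).map ι).det ≠ 0 := by
    intro g f
    have := (RingHom.map_det ι ((g : Matrix (Fin 2) (Fin 2) R) *
      (f : Matrix (Fin 2) (Fin 2) R))).symm
    rw [Matrix.det_mul, g.det_coe, one_mul] at this
    have h2 := hne _ (hFE f f.2).1
    rw [← this] at h2
    exact h2
  have hdetg : ∀ (g : Matrix.SpecialLinearGroup (Fin 2) R),
      ((g : Matrix (Fin 2) (Fin 2) R).map ι).det ≠ 0 := by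
    intro g
    have := (RingHom.map_det ι (g : Matrix (Fin 2) (Fin 2) R)).symm
    rw [g.det_coe, map_one] at this
    have h2 : (1 : ℂ) ≠ 0 := one_ne_zero
    rw [← this] at h2
    exact h2
  have hmem : ((1, 0, 2 / c₂) : ℝ × ℂ × ℝ) ∈ sieg c₁ c₂ := by
    refine ⟨by simp, by simpa using h₁, ?_⟩
    simp only [hdisc]
    simp
    field_simp
    norm_num
  have hsub := sieg_sub_posX c₁ c₂ h₂
  have hposne : posX.Nonempty := ⟨_, hsub hmem⟩
  have : ContractibleSpace posX := posX_convex.contractibleSpace hposne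
  have : LocallyPathConnectedSpace posX := posX_open.locallyPathConnectedSpace
  have : Finite F := hFf
  let V : Matrix.SpecialLinearGroup (Fin 2) R × F → Set posX := fun e =>
    {A | hact (((e.1 : Matrix (Fin 2) (Fin 2) R) * (e.2 : Matrix (Fin 2) (Fin 2) R)).map ι) A
      ∈ sieg c₁ c₂}
  refine fp_of_action (X := posX) V ?_ ?_ ?_ ?_ ?_ ?_
  · intro e
    exact (sieg_open c₁ c₂).preimage ((hact_continuous _).comp continuous_subtype_val)
  · intro e
    rw [← Topology.IsInducing.subtypeVal.isPreconnected_image]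
    have : (Subtype.val '' V e) = posX ∩ (hact (((e.1 : Matrix (Fin 2) (Fin 2) R) *
        (e.2 : Matrix (Fin 2) (Fin 2) R)).map ι)) ⁻¹' sieg c₁ c₂ := by
      ext A
      constructor
      · rintro ⟨B, hB, rfl⟩
        exact ⟨B.2, hB⟩
      · rintro ⟨h, h'⟩
        exact ⟨⟨A, h⟩, h', rfl⟩
    rw [this]
    exact (posX_convex.inter
      ((sieg_convex c₁ c₂ h₂).is_linear_preimage (hact_linear _))).isPreconnected
  · rintro ⟨g, f⟩
    have hd := hdet g f
    set M := (((g : Matrix (Fin 2) (Fin 2) R) * (f : Matrix (Fin 2) (Fin 2) R)).map ι) with hM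
    have hu : IsUnit M.det := isUnit_iff_ne_zero.2 hd
    have hd' : (M⁻¹).det ≠ 0 := by
      have := congrArg Matrix.det (Matrix.nonsing_inv_mul M hu)
      rw [Matrix.det_mul, Matrix.det_one] at this
      intro h0
      rw [h0, zero_mul] at this
      exact zero_ne_one this
    refine ⟨⟨hact M⁻¹ (1, 0, 2 / c₂), posX_hact hd' (hsub hmem)⟩, ?_⟩
    show hact M (hact M⁻¹ (1, 0, 2 / c₂)) ∈ sieg c₁ c₂
    rw [← hact_mul, Matrix.nonsing_inv_mul M hu, hact_one]
    exact hmem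
  · rintro ⟨A, hA⟩
    obtain ⟨M, h1, h2, h3⟩ := hcov A hA
    obtain ⟨g, f, hf, hgf⟩ := hF M h1 h2
    refine ⟨(g, ⟨f, hf⟩), ?_⟩
    show hact (((g : Matrix (Fin 2) (Fin 2) R) * f).map ι) A ∈ sieg c₁ c₂
    rw [hgf]; exact h3
  · rintro k g h f f' ⟨⟨A, hA⟩, h1, h2⟩
    have hk : ∀ (g : Matrix.SpecialLinearGroup (Fin 2) R) (f : F),
        hact ((((k * g : Matrix.SpecialLinearGroup (Fin 2) R) : Matrix (Fin 2) (Fin 2) R) *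
          (f : Matrix (Fin 2) (Fin 2) R)).map ι)
          (hact (((k⁻¹ : Matrix.SpecialLinearGroup (Fin 2) R) : Matrix (Fin 2) (Fin 2) R).map ι) A)
        = hact (((g : Matrix (Fin 2) (Fin 2) R) * (f : Matrix (Fin 2) (Fin 2) R)).map ι) A := by
      intro g f
      rw [← hact_mul, ← Matrix.map_mul, ← Matrix.mul_assoc,
        ← Matrix.SpecialLinearGroup.coe_mul, inv_mul_cancel_left]
    refine ⟨⟨hact (((k⁻¹ : Matrix.SpecialLinearGroup (Fin 2) R) :
      Matrix (Fin 2) (Fin 2) R).map ι) A, posX_hact (hdetg _) hA⟩, ?_, ?_⟩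
    · exact (congrArg (· ∈ sieg c₁ c₂) (hk g f)).mpr h1
    · exact (congrArg (· ∈ sieg c₁ c₂) (hk h f')).mpr h2
  · have : (⋃ p : F × F, {s : Matrix.SpecialLinearGroup (Fin 2) R |
        ∃ A, hact ((p.1 : Matrix (Fin 2) (Fin 2) R).map ι) A ∈ sieg c₁ c₂ ∧
      hact (((s : Matrix (Fin 2) (Fin 2) R) * (p.2 : Matrix (Fin 2) (Fin 2) R)).map ι) A
        ∈ sieg c₁ c₂}).Finite :=
      Set.finite_iUnion fun p => siegel_finite ι hinj F1 c₁ c₂ D h₁ h₂ hD _ _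
        (hFE _ p.1.2) (hFE _ p.2.2)
    refine this.subset ?_
    rintro s ⟨f, f', ⟨A, hA⟩, h1, h2⟩
    refine Set.mem_iUnion.2 ⟨(f, f'), A, ?_, h2⟩
    have h1' : hact ((((1 : Matrix.SpecialLinearGroup (Fin 2) R) : Matrix (Fin 2) (Fin 2) R) *
      (f : Matrix (Fin 2) (Fin 2) R)).map ι) A ∈ sieg c₁ c₂ := h1
    rw [Matrix.SpecialLinearGroup.coe_one, Matrix.one_mul] at h1'
    exact h1'

theorem PSL2_fp (h : Group.IsFinitelyPresented (Matrix.SpecialLinearGroup (Fin 2) R)) :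
    ∃ (n : ℕ) (S : Finset (FreeGroup (Fin n))),
      Nonempty ((Matrix.SpecialLinearGroup (Fin 2) R ⧸
        Subgroup.center (Matrix.SpecialLinearGroup (Fin 2) R)) ≃*
          PresentedGroup (S : Set (FreeGroup (Fin n)))) := by
  have : NeZero (max (Fintype.card (Fin 2)) 1) := ⟨by simp⟩
  have : Finite (Subgroup.center (Matrix.SpecialLinearGroup (Fin 2) R)) :=
    Finite.of_equiv _ (Matrix.SpecialLinearGroup.center_equiv_rootsOfUnity
      (n := Fin 2) (R := R)).symm.toEquiv
  have : Group.IsFinitelyPresented (Matrix.SpecialLinearGroup (Fin 2) R ⧸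
      Subgroup.center (Matrix.SpecialLinearGroup (Fin 2) R)) :=
    Group.IsFinitelyPresented.quotient _ (Subgroup.IsFinitelyNormallyGenerated.of_FG _)
  obtain ⟨n, s, hs, ⟨e⟩⟩ := this.exists_mulEquiv_presentedGroup
  refine ⟨n, hs.toFinset, ?_⟩
  rw [Set.Finite.coe_toFinset]
  exact ⟨e⟩

end ring2

theorem theta_sq (d : ℕ) : (Complex.I * (Real.sqrt d : ℂ)) ^ 2 = -(d : ℂ) := by
  rw [mul_pow, Complex.I_sq, ← Complex.ofReal_pow, Real.sq_sqrt (Nat.cast_nonneg d)]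
  simp

theorem theta_int (d : ℕ) : IsIntegral ℤ (Complex.I * (Real.sqrt d : ℂ)) := by
  refine IsIntegral.of_pow (n := 2) (by norm_num) ?_
  rw [theta_sq]
  simpa using (isIntegral_algebraMap (R := ℤ) (A := ℂ) (x := -(d : ℤ)))

theorem Qd_nf (d : ℕ) : NumberField (Qd d) := by
  have : FiniteDimensional ℚ (Qd d) :=
    IntermediateField.adjoin.finiteDimensional (theta_int d).tower_top
  exact { to_charZero := inferInstance, to_finiteDimensional := this }

theorem Qd_norm (d : ℕ) (φ : Qd d →+* ℂ) (x : Qd d) : ‖φ x‖ = ‖(x : ℂ)‖ := by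
  let θ : Qd d := IntermediateField.AdjoinSimple.gen ℚ (Complex.I * (Real.sqrt d : ℂ))
  have hθ : ((θ : Qd d) : ℂ) = Complex.I * (Real.sqrt d : ℂ) :=
    IntermediateField.AdjoinSimple.coe_gen ℚ _
  have hθ2 : θ ^ 2 = -(d : Qd d) := by
    apply Subtype.ext
    push_cast
    rw [hθ, theta_sq]
  have h1 : φ θ ^ 2 = (Complex.I * (Real.sqrt d : ℂ)) ^ 2 := by
    rw [← map_pow, hθ2, theta_sq]; simp
  rcases sq_eq_sq_iff_eq_or_eq_neg.1 h1 with h | h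
  · have : φ.toRatAlgHom = (Qd d).val := by
      refine IntermediateField.algHom_ext_of_eq_adjoin _ rfl ?_
      rintro y rfl
      exact h
    have h2 := DFunLike.congr_fun this x
    have h3 : φ x = (x : ℂ) := h2
    rw [h3]
  · have : φ.toRatAlgHom = ((starRingEnd ℂ).toRatAlgHom).comp (Qd d).val := by
      refine IntermediateField.algHom_ext_of_eq_adjoin _ rfl ?_
      rintro y rfl
      refine Eq.trans (b := -(Complex.I * (Real.sqrt d : ℂ))) h ?_
      simp
    have h2 := DFunLike.congr_fun this x
    have h3 : φ x = starRingEnd ℂ (x : ℂ) := h2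
    rw [h3, RCLike.norm_conj]

theorem Od_finite (d : ℕ) (r : ℝ) : {x : Od d | ‖((x : Qd d) : ℂ)‖ ≤ r}.Finite := by
  have := Qd_nf d
  have h := NumberField.Embeddings.finite_of_norm_le (Qd d) ℂ r
  refine Set.Finite.of_finite_image (f := fun x : Od d => (x : Qd d)) (h.subset ?_)
    (NumberField.RingOfIntegers.coe_injective.injOn)
  rintro _ ⟨x, hx, rfl⟩
  refine ⟨x.2, fun φ => ?_⟩
  rw [Qd_norm]
  exact hx

theorem Od_dense (d : ℕ) (hd0 : 0 < d) (z : ℂ) :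
    ∃ x : Od d, ‖z - ((x : Qd d) : ℂ)‖ ≤ 1 + Real.sqrt d := by
  have hs : 0 < Real.sqrt d := Real.sqrt_pos.2 (by exact_mod_cast hd0)
  let θ : Qd d := IntermediateField.AdjoinSimple.gen ℚ (Complex.I * (Real.sqrt d : ℂ))
  have hθ : ((θ : Qd d) : ℂ) = Complex.I * (Real.sqrt d : ℂ) :=
    IntermediateField.AdjoinSimple.coe_gen ℚ _
  have hint : IsIntegral ℤ θ := by
    refine (isIntegral_algHom_iff ((Qd d).val.restrictScalars ℤ) Subtype.val_injective).1 ?_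
    have h := theta_int d
    rw [← hθ] at h
    exact h
  let t : Od d := ⟨θ, hint⟩
  refine ⟨(round z.re : Od d) + (round (z.im / Real.sqrt d) : Od d) * t, ?_⟩
  have he : (((((round z.re : ℤ) : Od d) + ((round (z.im / Real.sqrt d) : ℤ) : Od d) * t : Od d)
      : Qd d) : ℂ) = (round z.re : ℂ) + (round (z.im / Real.sqrt d) : ℂ) *
        (Complex.I * (Real.sqrt d : ℂ)) := by
    rw [← hθ]
    simp [t]
    try rfl
  rw [he]
  refine (Complex.norm_le_abs_re_add_abs_im _).trans ?_
  have h1 := abs_sub_round z.re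
  have h2 := abs_sub_round (z.im / Real.sqrt d)
  have h3 : |z.im - round (z.im / Real.sqrt d) * Real.sqrt d| ≤ Real.sqrt d := by
    have : z.im - round (z.im / Real.sqrt d) * Real.sqrt d =
      (z.im / Real.sqrt d - round (z.im / Real.sqrt d)) * Real.sqrt d := by
      field_simp
    rw [this, abs_mul, abs_of_pos hs]
    nlinarith
  simp
  linarith

/-- Every Bianchi group `PSL₂(O_d)` is finitely presented: it is isomorphic to a group
presented by finitely many generators and finitely many relators. -/
theorem bianchi_finitely_presented (d : ℕ) (hd : Squarefree d) (hd0 : 0 < d) :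
    ∃ (n : ℕ) (R : Finset (FreeGroup (Fin n))),
      Nonempty (PSL2 (Od d) ≃* PresentedGroup (R : Set (FreeGroup (Fin n)))) := by
  have : NumberField (Qd d) := Qd_nf d
  let ι : Od d →+* ℂ := (algebraMap (Qd d) ℂ).comp (algebraMap (Od d) (Qd d))
  have hinj : Function.Injective ι :=
    (algebraMap (Qd d) ℂ).injective.comp NumberField.RingOfIntegers.coe_injective
  exact PSL2_fp (SL2_fp ι hinj (Od_finite d) (1 + Real.sqrt d) (Od_dense d hd0))
end

section
/- For every imaginary quadratic field K ⊂ ℂ with ring of integers O_K, the subgroup of SL₂(ℂ) consisting of matrices all of whose entries lie in O_K (the image of SL₂(O_K) under the embedding induced by O_K ⊂ ℂ) is a discrete subgroup of the topological group SL₂(ℂ). -/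
open NumberField

/-- The topology on `SL₂(ℂ)` induced from the entrywise topology on 2×2 complex
matrices. -/
noncomputable instance : TopologicalSpace (SL2 ℂ) :=
  TopologicalSpace.induced (fun g => (g : Matrix (Fin 2) (Fin 2) ℂ)) inferInstance

theorem bianchi_aux (K : Subfield ℂ) [NumberField K]
    (h2 : Module.finrank ℚ K = 2) (hK : IsEmpty (K →+* ℝ)) (a : 𝓞 K)
    (ha : ‖((a : K) : ℂ)‖ < 1) : a = 0 := by
  by_contra h0
  have : IsTotallyComplex K := ⟨fun v => by
    rw [← InfinitePlace.not_isReal_iff_isComplex]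
    intro hv
    exact hK.false (InfinitePlace.embedding_of_isReal hv)⟩
  have h3 := IsTotallyComplex.finrank K
  have h4 := InfinitePlace.card_eq_nrRealPlaces_add_nrComplexPlaces K
  have h5 := IsTotallyComplex.nrRealPlaces_eq_zero K
  have h6 : Fintype.card (InfinitePlace K) ≤ 1 := by omega
  have h7 := Fintype.card_le_one_iff_subsingleton.mp h6
  have := InfinitePlace.one_le_of_lt_one (w := InfinitePlace.mk K.subtype) h0
    (fun z hz => absurd (Subsingleton.elim _ _) hz)
  rw [InfinitePlace.apply] at this
  exact absurd ha (not_lt.mpr this)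

/-- For an imaginary quadratic field `K ⊂ ℂ` (a number field of degree 2 over `ℚ` with no
real embedding), the subgroup of `SL₂(ℂ)` consisting of matrices with entries in `O_K`
(i.e. the image of `SL₂(O_K)` under the embedding induced by `O_K ⊆ K ⊆ ℂ`) is a discrete
subgroup of `SL₂(ℂ)`. -/
theorem bianchi_discrete_in_SL2C (K : Subfield ℂ) [NumberField K]
    (h2 : Module.finrank ℚ K = 2) (hK : IsEmpty (K →+* ℝ)) :
    DiscreteTopology
      ((Matrix.SpecialLinearGroup.map
        (K.subtype.comp (algebraMap (𝓞 K) K))).range : Subgroup (SL2 ℂ)) := by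
  rw [discreteTopology_iff_isOpen_singleton]
  rintro ⟨g, a, rfl⟩
  set f := (Matrix.SpecialLinearGroup.map (n := Fin 2) (K.subtype.comp (algebraMap (𝓞 K) K))) with hf
  have hc : ∀ i j, Continuous (fun x : f.range => ‖(x : SL2 ℂ).1 i j - (f a).1 i j‖) := by
    intro i j
    have h1 : Continuous (fun g : SL2 ℂ => (g : Matrix (Fin 2) (Fin 2) ℂ)) :=
      continuous_induced_dom
    exact (((h1.comp continuous_subtype_val).matrix_elem i j).sub continuous_const).norm
  have ho : IsOpen (⋂ i, ⋂ j, {x : f.range | ‖(x : SL2 ℂ).1 i j - (f a).1 i j‖ < 1}) :=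
    isOpen_iInter_of_finite fun i => isOpen_iInter_of_finite fun j =>
      isOpen_lt (hc i j) continuous_const
  convert ho using 1
  ext ⟨x, b, rfl⟩
  simp only [Set.mem_singleton_iff, Set.mem_iInter, Set.mem_ofPred_eq]
  constructor
  · intro h i j
    have h' : f b = f a := congrArg Subtype.val h
    rw [h', sub_self, norm_zero]; exact one_pos
  · intro h
    have hab : b = a := by
      ext i j
      have := bianchi_aux K h2 hK (b.1 i j - a.1 i j) (by simpa [hf] using h i j)
      have h8 := sub_eq_zero.mp this
      exact congrArg (fun t : 𝓞 K => ((t : K) : ℂ)) h8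
    subst hab
    rfl
end

section
/- The Galois group over ℚ of the polynomial x⁸ − x⁷ − 44x⁶ + 43x⁵ + 442x⁴ − 32x³ − 1311x² − 1156x − 241 (i.e., the Galois group of its splitting field over ℚ) is isomorphic to the binary tetrahedral group Â₄ ≅ SL₂(𝔽₃), the double cover of the alternating group A₄ of order 24. -/
open Polynomial

def ph {R : Type*} [CommRing R] (x : R) : R :=
   - 470649*x^7 + 1061420*x^6 + 19812457*x^5 - 44979522*x^4 - 166976962*x^3 + 227002575*x^2 + 385308534*x + 65340383
def pa1 {R : Type*} [CommRing R] (x : R) : R :=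
  4333374*x^7 - 8027095*x^6 - 183732269*x^5 + 341413622*x^4 + 1618283564*x^3 - 1467849411*x^2 - 4361573062*x - 1494138349
def pa2 {R : Type*} [CommRing R] (x : R) : R :=
  15965238*x^7 - 33622958*x^6 - 666662036*x^5 + 1425691461*x^4 + 5535245138*x^3 - 6723311652*x^2 - 13942679966*x - 2859866463
def pa3 {R : Type*} [CommRing R] (x : R) : R :=
  9654734*x^7 - 16173352*x^6 - 414173681*x^5 + 696485822*x^4 + 3807756205*x^3 - 2943071152*x^2 - 10701947211*x - 3523908303
def pb1 {R : Type*} [CommRing R] (x : R) : R :=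
   - 3862725*x^7 + 6965675*x^6 + 163919812*x^5 - 296434100*x^4 - 1451306602*x^3 + 1240846836*x^2 + 3944139969*x + 1460922525
def pb2 {R : Type*} [CommRing R] (x : R) : R :=
  4526423*x^7 - 11754445*x^6 - 185819109*x^5 + 497791549*x^4 + 1427891834*x^3 - 2707841183*x^2 - 3337030151*x + 623405629
def pb3 {R : Type*} [CommRing R] (x : R) : R :=
   - 9127337*x^7 + 15615251*x^6 + 391191784*x^5 - 667860798*x^4 - 3586867912*x^3 + 2731547657*x^2 + 10220801824*x + 4497273071

def pf {R : Type*} [CommRing R] (x : R) : R :=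
  x^8 - x^7 - 44*x^6 + 43*x^5 + 442*x^4 - 32*x^3 - 1311*x^2 - 1156*x - 241

def ff {R : Type*} [CommRing R] (x y : R) : R := 32124559 * y - ph x

def fA {R : Type*} [CommRing R] (x y : R) : R :=
  32124559 * y^3 - pa1 x * y^2 + pa2 x * y - pa3 x

def fB {R : Type*} [CommRing R] (x y : R) : R :=
  32124559 * y^3 - pb1 x * y^2 + pb2 x * y - pb3 x

set_option maxHeartbeats 4000000 in
theorem prod_eq_zero_of_root {R : Type*} [CommRing R] (x y : R) (hx : pf x = 0) (hy : pf y = 0) :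
    (y - x) * ff x y * fA x y * fB x y = 0 := by
  unfold ff fA fB ph pa1 pa2 pa3 pb1 pb2 pb3
  unfold pf at hx hy
  linear_combination 32124559^3 * hy + ((41474536290828579342*x^14 - 192492520142567964860*x^13 - 3234723971245374685107*x^12 + 16189120765250699659354*x^11 + 81359189132461168162910*x^10 - 447760549430408527088485*x^9 - 743182087248393450354895*x^8 + 4674070038423362697767522*x^7 + 3417261402960773641877085*x^6 - 20581427461279134869791681*x^5 - 11957226908320750969028553*x^4 + 31766261205846577211512201*x^3 + 26959137659615870120004182*x^2 + 4455754426216405820780683*x - 33152136615196145608879) * y^0 +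
    ( - 48014997947781375876*x^14 + 192697978044227665504*x^13 + 3861979570413977764883*x^12 - 16256238567883057010248*x^11 - 104366141749922487253245*x^10 + 448455611423367516772746*x^9 + 1156100220451277387141847*x^8 - 4592747524860206909139268*x^7 - 7338245448945971725435697*x^6 + 18807017403075929523457365*x^5 + 30746280964370270428234339*x^4 - 19409680354099454674026603*x^3 - 61748462361430821563494684*x^2 - 32973951302542962276797840*x - 4455754426216405820780683) * y^1 +
    (2155726205273312586*x^14 + 77876369340212632227*x^13 - 616089538821241929462*x^12 - 5753432884275178494087*x^11 + 41298194248142456104117*x^10 + 127993427759805851428133*x^9 - 1036446513899835287670765*x^8 - 775928209131136407920031*x^7 + 10016378090335799183329222*x^6 + 941902699759738920077029*x^5 - 40176645868393576874797943*x^4 - 4430808371235129927992170*x^3 + 54540096302449782278359915*x^2 + 35694811414041632644002534*x + 6014813642927092156793658) * y^2 +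
    ( - 19792974361301373852*x^14 + 95081560193728740387*x^13 + 1473895267630234397242*x^12 - 7686835595334135380225*x^11 - 33558317544133285453393*x^10 + 196321554846116619046185*x^9 + 233788672105789723673968*x^8 - 1666246645509609223560521*x^7 - 841394294826806593376836*x^6 + 4267526873079896908986160*x^5 + 4738080415412974843122990*x^4 + 5584896271004489488474573*x^3 - 14678999783526597850403343*x^2 - 26430387946285317491588168*x - 5712610258457388292020051) * y^3 +
    (7878020451773113350*x^14 - 18895364901927645723*x^13 - 697997664340583187810*x^12 + 1714478796130415169190*x^11 + 22423379157840381017661*x^10 - 51783028648446971540348*x^9 - 331004726160240403662243*x^8 + 605237040222677712662789*x^7 + 2571143895912494217385133*x^6 - 2715819395739618765827307*x^5 - 10477655180434145410110172*x^4 + 1930205982199439719153397*x^3 + 17221939030103983695272131*x^2 + 10227241101696908018389407*x + 3257198906255740856283409) * y^4 +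
    ( - 7878020451773113350*x^13 + 38688339263229019575*x^12 + 600760377941581134837*x^11 - 3218235435153080822783*x^10 - 14354626538020059952820*x^9 + 87425292026584025687805*x^8 + 113420776705598789762505*x^7 - 880295122718947735672905*x^6 - 420130340454876020120279*x^5 + 3685303001106542752783244*x^4 + 1681893845171577631439410*x^3 - 5246150298682296260982597*x^2 - 5149244869196695395341552*x - 1282286450026315798436552) * y^5 +
    ( - 544837100489029555209*x^6 + 1453003615346235501906*x^5 + 21864803395997629030776*x^4 - 60500772429849845712432*x^3 - 152214016044527954150457*x^2 + 300136611832751806297356*x + 294776630445095921058341) * y^6) * hx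

theorem map_pf {R T : Type*} [CommRing R] [CommRing T] (φ : R →+* T) (x : R) :
    φ (pf x) = pf (φ x) := by
  simp [pf, map_ofNat φ]

theorem map_fA {R T : Type*} [CommRing R] [CommRing T] (φ : R →+* T) (x y : R) :
    φ (fA x y) = fA (φ x) (φ y) := by
  simp [fA, pa1, pa2, pa3, map_ofNat φ]

/-- labels: the nonzero vectors of `𝔽₃²` -/
def lvec : Fin 8 → ZMod 3 × ZMod 3 :=
  ![(0, 1), (0, 2), (1, 0), (1, 1), (1, 2), (2, 0), (2, 1), (2, 2)]

/-- the roots of `f` modulo `241` -/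
def res : Fin 8 → ℤ := ![0, 68, 20, 93, 179, 180, 81, 103]

def om (i j : Fin 8) : ZMod 3 := (lvec i).1 * (lvec j).2 - (lvec i).2 * (lvec j).1

theorem res_inj (i j : Fin 8) (h : (241 : ℤ) ∣ res i - res j) : i = j := by
  revert i j; decide +kernel

theorem res_root (i : Fin 8) : (241 : ℤ) ∣ pf (res i) := by
  revert i; decide +kernel

theorem resA (i j : Fin 8) (h : (241 : ℤ) ∣ fA (res i) (res j)) : om i j = 1 := by
  revert i j; decide +kernel

theorem resB (i j : Fin 8) (h : (241 : ℤ) ∣ fB (res i) (res j)) : om i j ≠ 1 := by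
  revert i j; decide +kernel

theorem resf (i j : Fin 8) (h : (241 : ℤ) ∣ ff (res i) (res j)) : om i j ≠ 1 := by
  revert i j; decide +kernel

theorem om_self (i : Fin 8) : om i i ≠ 1 := by
  revert i; decide +kernel

theorem lvec_surj (v : ZMod 3 × ZMod 3) (h : v ≠ 0) : ∃ i, lvec i = v := by
  revert v; decide +kernel

theorem lvec_inj : Function.Injective lvec := by
  unfold Function.Injective; decide +kernel

theorem char2_aux {k : Type*} [CommRing k] [Nontrivial k] (h2 : (2 : k) = 0) (x : k)
    (hu : x^6 + x^4 + x^2 + x + 1 = 0) (h : x ^ (2 ^ 8) = x) : False := by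
  have h3 : x ^ 8 = x^3 + x + 1 := by
    linear_combination (x^2 + 1) * hu + (- x^6 - x^4 - x^3 - x^2 - x - 1) * h2
  have h4 : x ^ 16 = x^4 + x := by
    have : x ^ 16 = (x ^ 8) ^ 2 := by ring
    rw [this, h3]
    linear_combination (1) * hu + (x ^ 3) * h2
  have h5 : x ^ 32 = x^3 + x^2 + x + 1 := by
    have : x ^ 32 = (x ^ 16) ^ 2 := by ring
    rw [this, h4]
    linear_combination (x^2 + 1) * hu + (- x^6 + x^5 - x^4 - x^3 - x^2 - x - 1) * h2
  have h6 : x ^ 64 = x := by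
    have : x ^ 64 = (x ^ 32) ^ 2 := by ring
    rw [this, h5]
    linear_combination (1) * hu + (x^5 + x^4 + 2*x^3 + x^2) * h2
  have h7 : x ^ 4 = x := by
    have : x ^ (2 ^ 8) = (x ^ 64) ^ 4 := by ring
    rw [this, h6] at h
    exact h
  have : (1 : k) = 0 := by
    linear_combination (x^3 + x + 1) * hu + (x ^ 5) * h7 +
      (- x^9 - x^7 - x^5 - x^4 - x^3 - x^2 - x) * h2
  exact one_ne_zero this

theorem char5_aux {k : Type*} [CommRing k] [Nontrivial k] (h5 : (5 : k) = 0) (x : k)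
    (hu : x^4 + 3*x^3 + 2*x^2 + 3 = 0) (h : x ^ (5 ^ 6) = x) : False := by
  have h1 : x ^ 5 = 2*x^3 + x^2 + 2*x + 4 := by
    linear_combination (x + 2) * hu + (- x^4 - 2*x^3 - x^2 - x - 2) * h5
  have h2 : x ^ 25 = 4*x^3 + 3*x + 3 := by
    have : x ^ 25 = (x ^ 5) ^ 5 := by ring
    rw [this, h1]
    linear_combination (2*x^11 + 4*x^10 + 4*x^9 + x^7 + x^6 + 3*x^5 + 4*x^4 + 4*x^3 + 2*x^2 + 4*x + 2) * hu + (6*x^15 + 14*x^14 + 44*x^13 + 132*x^12 + 239*x^11 + 461*x^10 + 782*x^9 + 1033*x^8 + 1419*x^7 + 1675*x^6 + 1601*x^5 + 1594*x^4 + 1274*x^3 + 766*x^2 + 509*x + 203) * h5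
  have h3 : x ^ 125 = 4*x^3 + 4*x^2 + 4*x := by
    have : x ^ 125 = (x ^ 25) ^ 5 := by ring
    rw [this, h2]
    linear_combination (4*x^11 + 3*x^10 + 3*x^9 + 2*x^7 + 2*x^5 + 4*x^4 + 3*x^3 + 3*x^2 + 2*x + 1) * hu + (204*x^15 - 3*x^14 + 764*x^13 + 765*x^12 + 1148*x^11 + 2301*x^10 + 2013*x^9 + 2590*x^8 + 2911*x^7 + 2156*x^6 + 1988*x^5 + 1534*x^4 + 806*x^3 + 483*x^2 + 241*x + 48) * h5
  have h4 : x ^ 625 = x := by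
    have : x ^ 625 = (x ^ 125) ^ 5 := by ring
    rw [this, h3]
    linear_combination (4*x^11 + 3*x^10 + 3*x^9 + 2*x^7 + 4*x^6 + 2*x^4 + 3*x^3 + 3*x) * hu + (204*x^15 + 1021*x^14 + 3068*x^13 + 6141*x^12 + 9212*x^11 + 10441*x^10 + 9211*x^9 + 6142*x^8 + 3069*x^7 + 1019*x^6 + 203*x^5 - 3*x^4 - 3*x^3 - 2*x) * h5
  have h7 : x ^ 25 = x := by
    have : x ^ (5 ^ 6) = (x ^ 625) ^ 25 := by ring
    rw [this, h4] at h
    exact h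
  rw [h2] at h7
  have : (1 : k) = 0 := by
    linear_combination (3*x^2) * hu + (3*x^3 + 4*x^2 + 2*x + 2) * h7 +
      (- 3*x^6 - 5*x^5 - 4*x^4 - 5*x^3 - 5*x^2 - 2*x - 1) * h5
  exact one_ne_zero this

section grp
open Matrix

abbrev SL23 := Matrix.SpecialLinearGroup (Fin 2) (ZMod 3)

theorem card_SL23 : Nat.card SL23 = 24 := by
  rw [Nat.card_eq_fintype_card]
  decide +kernel

def tu (t : ZMod 3) : SL23 := ⟨!![1, t; 0, 1], by simp⟩
def tl (t : ZMod 3) : SL23 := ⟨!![1, 0; t, 1], by simp⟩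

theorem tu_sq (t : ZMod 3) : tu t = tu (2 * t) * tu (2 * t) := by
  revert t; decide +kernel
theorem tl_sq (t : ZMod 3) : tl t = tl (2 * t) * tl (2 * t) := by
  revert t; decide +kernel

theorem elem_gen (g : SL23) : ∃ x y z w : ZMod 3, g = tu x * tl y * (tu z * tl w) := by
  revert g; decide +kernel

theorem index_two_false (H : Subgroup SL23) (h : H.index = 2) : False := by
  have hu : ∀ t, tu t ∈ H := fun t => tu_sq t ▸ Subgroup.mul_self_mem_of_index_two h _
  have hl : ∀ t, tl t ∈ H := fun t => tl_sq t ▸ Subgroup.mul_self_mem_of_index_two h _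
  have : H = ⊤ := by
    rw [eq_top_iff]
    intro g _
    obtain ⟨x, y, z, w, rfl⟩ := elem_gen g
    exact H.mul_mem (H.mul_mem (hu _) (hl _)) (H.mul_mem (hu _) (hl _))
  subst this
  simp at h

theorem full_of_orders {G : Type*} [Group G] (ρ : G →* SL23) (hρ : Function.Injective ρ)
    (a b : G) (ha : a ^ 8 ≠ 1) (hb : b ^ 6 ≠ 1) : Function.Surjective ρ := by
  have hfin : Finite G := Finite.of_injective ρ hρ
  have hc : Nat.card ρ.range = Nat.card G :=
    (Nat.card_congr (MonoidHom.ofInjective hρ).toEquiv).symm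
  have hd : Nat.card G ∣ 24 := by
    rw [← hc, ← card_SL23]; exact Subgroup.card_subgroup_dvd_card _
  have ha1 := (orderOf_dvd_natCard a)
  have hb1 := (orderOf_dvd_natCard b)
  have ha2 : ¬ orderOf a ∣ 8 := fun h => ha (orderOf_dvd_iff_pow_eq_one.mp h)
  have hb2 : ¬ orderOf b ∣ 6 := fun h => hb (orderOf_dvd_iff_pow_eq_one.mp h)
  have key : ∀ n ∈ Nat.divisors 24, (∃ m ∈ Nat.divisors n, ¬ m ∣ 8) →
      (∃ m ∈ Nat.divisors n, ¬ m ∣ 6) → n = 12 ∨ n = 24 := by decide +kernel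
  have hpos : Nat.card G ≠ 0 := Nat.card_pos.ne'
  have := key (Nat.card G) (by simp [hd])
    ⟨_, by simpa [Nat.mem_divisors, hpos] using ha1, ha2⟩
    ⟨_, by simpa [Nat.mem_divisors, hpos] using hb1, hb2⟩
  have hi := ρ.range.card_mul_index
  rw [hc, card_SL23] at hi
  rw [← MonoidHom.range_eq_top]
  rcases this with h | h
  · exact (index_two_false ρ.range (by rw [h] at hi; omega)).elim
  · rw [← Subgroup.index_eq_one]; rw [h] at hi; omega

theorem zmod3_aux (a b : ZMod 3) (h : a = 1 ↔ b = 1) (h' : -a = 1 ↔ -b = 1) : a = b := by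
  revert a b; decide

theorem om_neg (i j : Fin 8) : om j i = - om i j := by unfold om; ring

/-- a permutation representation preserving the symplectic relation gives a map to `SL₂(𝔽₃)` -/
theorem exists_hom {G : Type*} [Group G] (π : G →* Equiv.Perm (Fin 8))
    (hπ : Function.Injective π) (h : ∀ g i j, om (π g i) (π g j) = 1 ↔ om i j = 1) :
    ∃ ρ : G →* SL23, Function.Injective ρ := by
  have hom : ∀ g i j, om (π g i) (π g j) = om i j := by
    intro g i j
    refine zmod3_aux _ _ (h g i j) ?_
    rw [← om_neg, ← om_neg]; exact h g j i
  have lin1 : ∀ g i, (lvec (π g i)).1 =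
      (lvec (π g 2)).1 * (lvec i).1 + (lvec (π g 0)).1 * (lvec i).2 := by
    intro g i
    have e1 := hom g 2 0
    have e2 := hom g 2 i
    have e3 := hom g i 0
    have v2 : lvec 2 = (1, 0) := rfl
    have v0 : lvec 0 = (0, 1) := rfl
    simp only [om, v2, v0] at e1 e2 e3
    linear_combination (-(lvec (π g i)).1) * e1 + (lvec (π g 0)).1 * e2 + (lvec (π g 2)).1 * e3
  have lin2 : ∀ g i, (lvec (π g i)).2 =
      (lvec (π g 2)).2 * (lvec i).1 + (lvec (π g 0)).2 * (lvec i).2 := by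
    intro g i
    have e1 := hom g 2 0
    have e2 := hom g 2 i
    have e3 := hom g i 0
    have v2 : lvec 2 = (1, 0) := rfl
    have v0 : lvec 0 = (0, 1) := rfl
    simp only [om, v2, v0] at e1 e2 e3
    linear_combination (-(lvec (π g i)).2) * e1 + (lvec (π g 0)).2 * e2 + (lvec (π g 2)).2 * e3
  have hdet : ∀ g, (!![(lvec (π g 2)).1, (lvec (π g 0)).1; (lvec (π g 2)).2, (lvec (π g 0)).2] :
      Matrix (Fin 2) (Fin 2) (ZMod 3)).det = 1 := by
    intro g
    have e1 := hom g 2 0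
    have : om 2 0 = 1 := by decide
    rw [this] at e1
    simp only [om] at e1
    rw [Matrix.det_fin_two_of]
    linear_combination e1
  refine ⟨MonoidHom.mk' (fun g => ⟨_, hdet g⟩) ?_, ?_⟩
  · intro a b
    apply Subtype.ext
    change (!![_, _; _, _] : Matrix (Fin 2) (Fin 2) (ZMod 3)) = !![_, _; _, _] * !![_, _; _, _]
    rw [Matrix.mul_fin_two, map_mul]
    simp only [Equiv.Perm.mul_apply]
    rw [lin1 a (π b 2), lin1 a (π b 0), lin2 a (π b 2), lin2 a (π b 0)]
  · intro a b hab
    have hm := congrArg Subtype.val hab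
    change (!![_, _; _, _] : Matrix (Fin 2) (Fin 2) (ZMod 3)) = !![_, _; _, _] at hm
    have h00 := congrFun (congrFun hm 0) 0
    have h01 := congrFun (congrFun hm 0) 1
    have h10 := congrFun (congrFun hm 1) 0
    have h11 := congrFun (congrFun hm 1) 1
    simp at h00 h01 h10 h11
    apply hπ
    ext1 i
    apply lvec_inj
    apply Prod.ext
    · rw [lin1 a, lin1 b, h00, h01]
    · rw [lin2 a, lin2 b, h10, h11]

end grp

noncomputable def fZ : ℤ[X] :=
  X ^ 8 - X ^ 7 - 44 * X ^ 6 + 43 * X ^ 5 + 442 * X ^ 4 - 32 * X ^ 3 -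
        1311 * X ^ 2 - 1156 * X - 241

theorem eval_fZ {R : Type*} [CommRing R] (x : R) : (fZ.map (Int.castRingHom R)).eval x = pf x := by
  simp [fZ, pf, Polynomial.map_ofNat]

theorem fZ_monic : fZ.Monic := by
  unfold fZ; monicity!

theorem fZ_natDegree : fZ.natDegree = 8 := by
  unfold fZ; compute_degree!

section field
open NumberField

theorem exists_frob (K : Type) [Field K] [NumberField K] [IsGalois ℚ K] (q : ℕ) (hq : q.Prime) :
    ∃ (k : Type) (_ : Field k) (φ : 𝓞 K →+* k) (σ : Gal(K/ℚ)), (q : k) = 0 ∧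
      ∀ x, φ (σ • x) = φ x ^ q := by
  have hmax : (Ideal.span {(q : ℤ)}).IsMaximal := by
    have : (Ideal.span {(q : ℤ)}).IsPrime :=
      (Ideal.span_singleton_prime (by exact_mod_cast hq.ne_zero)).mpr
        (Nat.prime_iff_prime_int.mp hq)
    exact this.isMaximal (by simpa using hq.ne_zero)
  obtain ⟨P, hP, hPq⟩ := Ideal.exists_maximal_ideal_liesOver_of_isIntegral
    (S := 𝓞 K) (Ideal.span {(q : ℤ)})
  have hover : P.under ℤ = Ideal.span {(q : ℤ)} := hPq.over.symm
  have hqP : (q : 𝓞 K) ∈ P := by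
    have : (q : ℤ) ∈ P.under ℤ := by rw [hover]; exact Ideal.mem_span_singleton_self _
    simpa [Ideal.mem_comap] using this
  have hP0 : P ≠ ⊥ := by
    rintro rfl
    have : (q : 𝓞 K) = 0 := by simpa using hqP
    exact hq.ne_zero (by exact_mod_cast this)
  have hfin : Finite (𝓞 K ⧸ P) := Ideal.finiteQuotientOfFreeOfNeBot P hP0
  have hinv : Algebra.IsInvariant ℤ (𝓞 K) Gal(K/ℚ) := by
    refine ⟨fun b hb => ?_⟩
    have h1 : (b : K) ∈ Set.range (algebraMap ℚ K) := by
      rw [IsGalois.mem_range_algebraMap_iff_fixed]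
      intro g
      have := congrArg (algebraMap (𝓞 K) K) (hb g)
      exact this
    obtain ⟨a, ha⟩ := h1
    have hint : IsIntegral ℤ a := by
      have : IsIntegral ℤ (algebraMap ℚ K a) := by rw [ha]; exact b.isIntegral_coe
      exact (isIntegral_algebraMap_iff (algebraMap ℚ K).injective).mp this
    obtain ⟨n, hn⟩ := IsIntegrallyClosed.algebraMap_eq_of_integral hint
    refine ⟨n, ?_⟩
    apply RingOfIntegers.coe_injective
    refine Eq.trans ?_ ha
    rw [← hn]
    simp
  obtain ⟨σ, hσ⟩ := IsArithFrobAt.exists_of_isInvariant ℤ Gal(K/ℚ) P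
  let := Ideal.Quotient.field P
  refine ⟨𝓞 K ⧸ P, inferInstance, Ideal.Quotient.mk P, σ, ?_, ?_⟩
  · rw [← map_natCast (Ideal.Quotient.mk P)]
    exact Ideal.Quotient.eq_zero_iff_mem.mpr hqP
  · intro x
    have := hσ.mk_apply x
    rw [hover] at this
    have hc : Nat.card (ℤ ⧸ Ideal.span {(q : ℤ)}) = q := by
      rw [Nat.card_congr (Int.quotientSpanNatEquivZMod q).toEquiv, Nat.card_zmod]
    rw [hc] at this
    exact this

theorem frob_pow {K k : Type} [Field K] [NumberField K] [Field k] (φ : 𝓞 K →+* k) (σ : Gal(K/ℚ))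
    (q : ℕ) (h : ∀ x, φ (σ • x) = φ x ^ q) (n : ℕ) (x : 𝓞 K) :
    φ (σ ^ n • x) = φ x ^ (q ^ n) := by
  induction n with
  | zero => simp
  | succ n ih => rw [pow_succ', mul_smul, h, ih, ← pow_mul, pow_succ]

variable {K : Type} [Field K] [NumberField K] (S : Multiset (𝓞 K))
  (hS : fZ.map (Int.castRingHom (𝓞 K)) = (S.map (fun s => X - C s)).prod)

include hS

theorem map_red {k : Type} [Field k] (φ : 𝓞 K →+* k) :
    fZ.map (Int.castRingHom k) = ((S.map φ).map (fun s => X - C s)).prod := by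
  have := congrArg (Polynomial.map φ) hS
  rw [Polynomial.map_map, Polynomial.map_multiset_prod, Multiset.map_map] at this
  rw [Multiset.map_map]
  rw [RingHom.ext_int (Int.castRingHom k) (φ.comp (Int.castRingHom (𝓞 K))), this]
  congr 2
  ext1 s; simp

theorem root_lift {k : Type} [Field k] (φ : 𝓞 K →+* k) (y : k) (hy : pf y = 0) :
    ∃ s ∈ S, φ s = y := by
  rw [← eval_fZ, map_red S hS φ, Polynomial.eval_multiset_prod, Multiset.map_map] at hy
  have := Multiset.prod_eq_zero_iff.mp hy
  obtain ⟨t, ht, h⟩ := Multiset.mem_map.mp this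
  obtain ⟨s, hs, rfl⟩ := Multiset.mem_map.mp ht
  exact ⟨s, hs, (by simpa [sub_eq_zero] using h : y = φ s).symm⟩

theorem root_of_factor {k : Type} [Field k] (φ : 𝓞 K →+* k) (u w : k[X])
    (huw : fZ.map (Int.castRingHom k) = u * w) (hu : u.degree ≠ 0) :
    ∃ s ∈ S, u.eval (φ s) = 0 := by
  have hs : (fZ.map (Int.castRingHom k)).Splits := by
    rw [map_red S hS φ]
    apply Polynomial.Splits.multisetProd
    intro p hp
    obtain ⟨s, _, rfl⟩ := Multiset.mem_map.mp hp
    exact Polynomial.Splits.X_sub_C s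
  have h0 : fZ.map (Int.castRingHom k) ≠ 0 := (fZ_monic.map _).ne_zero
  obtain ⟨y, hy⟩ := (hs.of_dvd h0 ⟨w, huw⟩).exists_eval_eq_zero hu
  obtain ⟨s, hsS, rfl⟩ := root_lift S hS φ y (by rw [← eval_fZ, huw, Polynomial.eval_mul, hy, zero_mul])
  exact ⟨s, hsS, hy⟩

theorem root_mem_iff (x : 𝓞 K) : x ∈ S ↔ pf x = 0 := by
  rw [← eval_fZ, hS, Polynomial.eval_multiset_prod, Multiset.map_map, Multiset.prod_eq_zero_iff,
    Multiset.mem_map]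
  constructor
  · intro h; exact ⟨x, h, by simp⟩
  · rintro ⟨s, hs, h⟩
    have : x = s := by simpa [sub_eq_zero] using h
    exact this ▸ hs

theorem card_S : S.card = 8 := by
  have := congrArg Polynomial.natDegree hS
  rw [Polynomial.natDegree_multiset_prod_X_sub_C_eq_card, fZ_monic.natDegree_map, fZ_natDegree] at this
  exact this.symm

theorem exists_a [IsGalois ℚ K] : ∃ a : Gal(K/ℚ), a ^ 8 ≠ 1 := by
  obtain ⟨k, _, φ, σ, h2, h⟩ := exists_frob K 2 Nat.prime_two
  refine ⟨σ, fun hσ => ?_⟩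
  have h2' : (2 : k[X]) = 0 := by
    have := congrArg (C : k → k[X]) h2
    rw [map_natCast, map_zero] at this
    exact_mod_cast this
  obtain ⟨s, hs, h0⟩ := root_of_factor S hS φ (X^6 + X^4 + X^2 + X + 1) (X^2 + X + 1)
    (by
      simp only [fZ, Polynomial.map_sub, Polynomial.map_add, Polynomial.map_mul,
        Polynomial.map_pow, Polynomial.map_X, Polynomial.map_ofNat]
      linear_combination (-X^7 - 23*X^6 + 21*X^5 + 220*X^4 - 17*X^3 - 657*X^2 - 579*X - 121) * h2')
    (by
      have : (X^6 + X^4 + X^2 + X + 1 : k[X]).degree = 6 := by compute_degree!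
      rw [this]; decide)
  refine char2_aux (by exact_mod_cast h2) (φ s) (by simpa using h0) ?_
  rw [← frob_pow φ σ 2 h 8, hσ, one_smul]

theorem exists_b [IsGalois ℚ K] : ∃ a : Gal(K/ℚ), a ^ 6 ≠ 1 := by
  obtain ⟨k, _, φ, σ, h2, h⟩ := exists_frob K 5 Nat.prime_five
  refine ⟨σ, fun hσ => ?_⟩
  have h2' : (5 : k[X]) = 0 := by
    have := congrArg (C : k → k[X]) h2
    rw [map_natCast, map_zero] at this
    exact_mod_cast this
  obtain ⟨s, hs, h0⟩ := root_of_factor S hS φ (X^4 + 3*X^3 + 2*X^2 + 3)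
      (X^4 + X^3 + X^2 + 3*X + 3)
    (by
      simp only [fZ, Polynomial.map_sub, Polynomial.map_add, Polynomial.map_mul,
        Polynomial.map_pow, Polynomial.map_X, Polynomial.map_ofNat]
      linear_combination (-X^7 - 10*X^6 + 7*X^5 + 85*X^4 - 10*X^3 - 264*X^2 - 233*X - 50) * h2')
    (by
      have : (X^4 + 3*X^3 + 2*X^2 + 3 : k[X]).degree = 4 := by compute_degree!
      rw [this]; decide)
  refine char5_aux (by exact_mod_cast h2) (φ s) (by simpa using h0) ?_
  rw [← frob_pow φ σ 5 h 6, hσ, one_smul]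

theorem exists_perm [IsGalois ℚ K] (hfaith : ∀ g : Gal(K/ℚ), (∀ s ∈ S, g • s = s) → g = 1) :
    ∃ π : Gal(K/ℚ) →* Equiv.Perm (Fin 8), Function.Injective π ∧
      ∀ g i j, om (π g i) (π g j) = 1 ↔ om i j = 1 := by
  obtain ⟨k, _, φ, -, hp, -⟩ := exists_frob K 241 (by norm_num)
  have hchar : CharP k 241 := by
    have : Fact (Nat.Prime 241) := ⟨by norm_num⟩
    obtain ⟨c, hc⟩ := CharP.exists k
    have h1 : c ∣ 241 := (CharP.cast_eq_zero_iff k c 241).mp hp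
    have h2 : c ≠ 1 := CharP.char_ne_one k c
    rcases (Nat.dvd_prime this.out).mp h1 with h | h
    · exact (h2 h).elim
    · exact h ▸ hc
  have hz : ∀ n : ℤ, (n : k) = 0 ↔ (241 : ℤ) ∣ n := fun n => by
    exact_mod_cast CharP.intCast_eq_zero_iff k 241 n
  have hr : ∀ i, ∃ s ∈ S, φ s = (res i : k) := by
    intro i
    apply root_lift S hS φ
    have : pf (res i : k) = ((pf (res i) : ℤ) : k) := by simp [pf]
    rw [this, hz]; exact res_root i
  choose r hrS hrφ using hr
  have hrinj : Function.Injective r := by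
    intro i j hij
    apply res_inj
    rw [← hz]; push_cast; rw [← hrφ, ← hrφ, hij, sub_self]
  have hrsurj : ∀ s, s ∈ S → ∃ i, r i = s := by
    classical
    have hsub : Finset.univ.image r ⊆ S.toFinset := by
      intro s hs
      obtain ⟨i, _, rfl⟩ := Finset.mem_image.mp hs
      exact Multiset.mem_toFinset.mpr (hrS i)
    have hcard : S.toFinset.card ≤ (Finset.univ.image r).card := by
      rw [Finset.card_image_of_injective _ hrinj, Finset.card_univ, Fintype.card_fin, ← card_S S hS]
      exact Multiset.toFinset_card_le S
    have := Finset.eq_of_subset_of_card_le hsub hcard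
    intro s hs
    have : s ∈ Finset.univ.image r := this ▸ Multiset.mem_toFinset.mpr hs
    simpa using this
  have hsm : ∀ (g : Gal(K/ℚ)) (s : 𝓞 K), s ∈ S → g • s ∈ S := by
    intro g s hs
    rw [root_mem_iff S hS] at hs ⊢
    have h1 : pf (g • s) = g • pf s := by
      have := map_pf (MulSemiringAction.toRingHom Gal(K/ℚ) (𝓞 K) g) s
      exact this.symm
    rw [h1, hs, smul_zero]
  have hidx : ∀ (g : Gal(K/ℚ)) (i : Fin 8), ∃ j, r j = g • r i := fun g i =>
    hrsurj _ (hsm g _ (hrS i))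
  choose p hpr using hidx
  have hp1 : ∀ i, p 1 i = i := fun i => hrinj (by rw [hpr, one_smul])
  have hpm : ∀ g h i, p (g * h) i = p g (p h i) := fun g h i =>
    hrinj (by rw [hpr, hpr, hpr, mul_smul])
  let π : Gal(K/ℚ) →* Equiv.Perm (Fin 8) := MonoidHom.mk'
    (fun g => ⟨p g, p g⁻¹, fun i => by rw [← hpm, inv_mul_cancel, hp1],
      fun i => by rw [← hpm, mul_inv_cancel, hp1]⟩)
    (fun g h => Equiv.ext (hpm g h))
  have hπ : ∀ g i, r (π g i) = g • r i := hpr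
  have hrel : ∀ i j, fA (r i) (r j) = 0 ↔ om i j = 1 := by
    intro i j
    have eA : φ (fA (r i) (r j)) = ((fA (res i) (res j) : ℤ) : k) := by
      simp [fA, pa1, pa2, pa3, hrφ, map_ofNat φ]
    have eB : φ (fB (r i) (r j)) = ((fB (res i) (res j) : ℤ) : k) := by
      simp [fB, pb1, pb2, pb3, hrφ, map_ofNat φ]
    have ef : φ (ff (r i) (r j)) = ((ff (res i) (res j) : ℤ) : k) := by
      simp [ff, ph, hrφ, map_ofNat φ]
    constructor
    · intro h
      apply resA
      rw [← hz, ← eA, h, map_zero]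
    · intro h
      have h0 := prod_eq_zero_of_root (r i) (r j) ((root_mem_iff S hS _).mp (hrS i))
        ((root_mem_iff S hS _).mp (hrS j))
      rcases mul_eq_zero.mp h0 with h0 | h0
      · rcases mul_eq_zero.mp h0 with h0 | h0
        · rcases mul_eq_zero.mp h0 with h0 | h0
          · have : j = i := hrinj (sub_eq_zero.mp h0)
            subst this
            exact (om_self _ h).elim
          · exact (resf i j (by rw [← hz, ← ef, h0, map_zero]) h).elim
        · exact h0
      · exact (resB i j (by rw [← hz, ← eB, h0, map_zero]) h).elim
  refine ⟨π, ?_, ?_⟩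
  · rw [injective_iff_map_eq_one]
    intro g hg
    apply hfaith
    intro s hs
    obtain ⟨i, rfl⟩ := hrsurj s hs
    rw [← hπ, hg]; rfl
  · intro g i j
    rw [← hrel, ← hrel, hπ, hπ]
    have h1 : fA (g • r i) (g • r j) = g • fA (r i) (r j) := by
      have := map_fA (MulSemiringAction.toRingHom Gal(K/ℚ) (𝓞 K) g) (r i) (r j)
      exact this.symm
    rw [h1, smul_eq_zero_iff_eq]

theorem main_K [IsGalois ℚ K] (hfaith : ∀ g : Gal(K/ℚ), (∀ s ∈ S, g • s = s) → g = 1) :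
    Nonempty (Gal(K/ℚ) ≃* Matrix.SpecialLinearGroup (Fin 2) (ZMod 3)) := by
  obtain ⟨π, hπ, h⟩ := exists_perm S hS hfaith
  obtain ⟨ρ, hρ⟩ := exists_hom π hπ h
  obtain ⟨a, ha⟩ := exists_a S hS
  obtain ⟨b, hb⟩ := exists_b S hS
  exact ⟨MulEquiv.ofBijective ρ ⟨hρ, full_of_orders ρ hρ a b ha hb⟩⟩

end field

theorem main_splitting (K : Type) [Field K] [inst : Algebra ℚ K] (f : ℚ[X])
    (hf : f = fZ.map (Int.castRingHom ℚ)) [hsf : IsSplittingField ℚ K f] :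
    Nonempty (Gal(K/ℚ) ≃* Matrix.SpecialLinearGroup (Fin 2) (ZMod 3)) := by
  have hcz : CharZero K := algebraRat.charZero K
  obtain rfl : inst = DivisionRing.toRatAlgebra := Subsingleton.elim _ _
  have hfd : FiniteDimensional ℚ K := IsSplittingField.finiteDimensional K f
  have : NumberField K := { }
  have : Normal ℚ K := Normal.of_isSplittingField f
  have : IsGalois ℚ K := ⟨⟩
  have hsp : (f.map (algebraMap ℚ K)).Splits := IsSplittingField.splits K f
  have hmap : f.map (algebraMap ℚ K) = fZ.map (Int.castRingHom K) := by
    rw [hf, Polynomial.map_map]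
    congr 1
    exact RingHom.ext_int _ _
  have hmon : (f.map (algebraMap ℚ K)).Monic := by rw [hmap]; exact fZ_monic.map _
  have hprod := hsp.eq_prod_roots_of_monic hmon
  have hint : ∀ x ∈ (f.map (algebraMap ℚ K)).roots, IsIntegral ℤ x := by
    intro x hx
    refine ⟨fZ, fZ_monic, ?_⟩
    rw [hmap] at hx
    have := Polynomial.isRoot_of_mem_roots hx
    rw [Polynomial.IsRoot, Polynomial.eval_map] at this
    exact this
  obtain ⟨S, hS⟩ : ∃ S : Multiset (NumberField.RingOfIntegers K),
      S.map (algebraMap _ K) = (f.map (algebraMap ℚ K)).roots := by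
    let e : {x // x ∈ (f.map (algebraMap ℚ K)).roots} → NumberField.RingOfIntegers K :=
      fun x => ⟨x.1, hint x.1 x.2⟩
    refine ⟨(f.map (algebraMap ℚ K)).roots.attach.map e, ?_⟩
    rw [Multiset.map_map]
    exact Multiset.attach_map_val _
  refine main_K (K := K) S ?_ ?_
  · apply Polynomial.map_injective (algebraMap _ K) NumberField.RingOfIntegers.coe_injective
    rw [Polynomial.map_map, Polynomial.map_multiset_prod, Multiset.map_map,
      RingHom.ext_int ((algebraMap (NumberField.RingOfIntegers K) K).comp _) (Int.castRingHom K),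
      ← hmap, hprod, ← hS, Multiset.map_map]
    congr 2
    ext1 s; simp
  · intro g hg
    have hadj := IsSplittingField.adjoin_rootSet K f
    have : (g : K →ₐ[ℚ] K) = AlgHom.id ℚ K := by
      apply AlgHom.ext_of_adjoin_eq_top hadj
      intro x hx
      have hx' : x ∈ (f.map (algebraMap ℚ K)).roots := by
        rw [Polynomial.mem_rootSet] at hx
        rw [Polynomial.mem_roots hmon.ne_zero, Polynomial.IsRoot, Polynomial.eval_map]
        exact hx.2
      rw [← hS] at hx'
      obtain ⟨s, hs, rfl⟩ := Multiset.mem_map.mp hx'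
      exact congrArg (algebraMap _ K) (hg s hs)
    ext x
    exact DFunLike.congr_fun this x

/-- The Galois group over `ℚ` of `x⁸ - x⁷ - 44x⁶ + 43x⁵ + 442x⁴ - 32x³ - 1311x² - 1156x - 241`
is isomorphic to the binary tetrahedral group `Â₄ ≅ SL₂(𝔽₃)`. -/
theorem galois_group_binary_tetrahedral :
    Nonempty ((X ^ 8 - X ^ 7 - 44 * X ^ 6 + 43 * X ^ 5 + 442 * X ^ 4 - 32 * X ^ 3 -
        1311 * X ^ 2 - 1156 * X - 241 : ℚ[X]).Gal ≃*
      Matrix.SpecialLinearGroup (Fin 2) (ZMod 3)) := by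
  have hf : (X ^ 8 - X ^ 7 - 44 * X ^ 6 + 43 * X ^ 5 + 442 * X ^ 4 - 32 * X ^ 3 -
        1311 * X ^ 2 - 1156 * X - 241 : ℚ[X]) = fZ.map (Int.castRingHom ℚ) := by
    simp [fZ, Polynomial.map_ofNat]
  exact main_splitting _ _ hf
end
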